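/- Let q be a fixed prime power. Then lim_{n→∞} G_n / q^{n²+n} = ∏_{j ≥ 1} (1 - q^{-j})^{-j}, where the infinite product converges. -/

import Mathlib

/-- `G_n`: the number of ordered pairs of commuting `n × n` matrices over `F`. -/
noncomputable def commPairs (F : Type) [Field F] [Fintype F] (n : ℕ) : ℕ :=
  Nat.card {P : Matrix (Fin n) (Fin n) F × Matrix (Fin n) (Fin n) F //
    P.1 * P.2 = P.2 * P.1}

namespace FF
set_option linter.unusedSectionVars false
set_option linter.unusedVariables false
variable (F : Type) [Field F] [Fintype F]

/-- order of the general linear group -/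
noncomputable def gl (n : ℕ) : ℕ := Nat.card ((Fin n → F) ≃ₗ[F] (Fin n → F))

/-- number of injective linear maps, explicit -/
def injF (q r n : ℕ) : ℕ := ∏ i : Fin r, (q ^ n - q ^ (i : ℕ))

variable {F}

theorem card_equiv_eq {V W : Type} [AddCommGroup V] [Module F V] [FiniteDimensional F V]
    [AddCommGroup W] [Module F W] [FiniteDimensional F W]
    (n : ℕ) (hV : Module.finrank F V = n) (hW : Module.finrank F W = n) :
    Nat.card (V ≃ₗ[F] W) = gl F n := by
  let e : V ≃ₗ[F] (Fin n → F) := LinearEquiv.ofFinrankEq _ _ (by simp [hV])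
  let f : W ≃ₗ[F] (Fin n → F) := LinearEquiv.ofFinrankEq _ _ (by simp [hW])
  exact Nat.card_congr
    { toFun := fun g => (e.symm.trans g).trans f
      invFun := fun g => (e.trans g).trans f.symm
      left_inv := fun g => by ext; simp
      right_inv := fun g => by ext; simp }

theorem card_inj {V : Type} [AddCommGroup V] [Module F V] [FiniteDimensional F V]
    (r n : ℕ) (hV : Module.finrank F V = n) (hr : r ≤ n) :
    Nat.card {j : (Fin r → F) →ₗ[F] V // Function.Injective j} = injF (Fintype.card F) r n := by
  have : Finite V := Module.finite_of_finite F
  have : Fintype V := Fintype.ofFinite V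
  rw [injF, ← hV, ← card_linearIndependent (K := F) (V := V) (hV ▸ hr)]
  refine Nat.card_congr ((((Pi.basisFun F (Fin r)).constr F).symm.toEquiv).subtypeEquiv ?_)
  intro j
  rw [← LinearMap.ker_eq_bot]
  have h := (Pi.basisFun F (Fin r)).linearIndependent
  constructor
  · intro hj
    exact h.map' j hj
  · intro hj
    have hc : j = (Pi.basisFun F (Fin r)).constr F (fun i => j (Pi.basisFun F (Fin r) i)) :=
      ((Pi.basisFun F (Fin r)).constr_self F j).symm
    rw [LinearMap.ker_eq_bot, hc]
    apply (Pi.basisFun F (Fin r)).injective_constr_of_linearIndependent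
    exact hj

theorem gl_eq (n : ℕ) : gl F n = injF (Fintype.card F) n n := by
  rw [← card_inj (F := F) (V := Fin n → F) n n (by simp) le_rfl]
  exact Nat.card_congr
    { toFun := fun e => ⟨e.toLinearMap, e.injective⟩
      invFun := fun j => LinearEquiv.ofInjectiveEndo j.1 j.2
      left_inv := fun e => by ext; simp
      right_inv := fun j => by ext; simp }

theorem gl_pos (n : ℕ) : 0 < gl F n := by
  rw [gl]
  have : Finite ((Fin n → F) ≃ₗ[F] (Fin n → F)) :=
    Finite.of_injective (fun e => (e : (Fin n → F) → (Fin n → F))) DFunLike.coe_injective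
  have : Nonempty ((Fin n → F) ≃ₗ[F] (Fin n → F)) := ⟨LinearEquiv.refl _ _⟩
  exact Nat.card_pos

theorem injF_mul (q r a : ℕ) :
    injF q r (r + a) * (q ^ (r * a) * injF q a a) = injF q (r + a) (r + a) := by
  unfold injF
  rw [Fin.prod_univ_add]
  congr 1
  rw [pow_mul]
  rw [show (q ^ r) ^ a = ∏ i : Fin a, q ^ r by simp, ← Finset.prod_mul_distrib]
  refine Finset.prod_congr rfl fun i _ => ?_
  simp [Nat.mul_sub, pow_add]

theorem injF_eq_zero (q r n : ℕ) (h : n < r) : injF q r n = 0 := by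
  unfold injF
  exact Finset.prod_eq_zero (Finset.mem_univ ⟨n, h⟩) (by simp)

theorem card_surj {V W : Type} [AddCommGroup V] [Module F V] [FiniteDimensional F V]
    [AddCommGroup W] [Module F W] [FiniteDimensional F W]
    (r n : ℕ) (hV : Module.finrank F V = n) (hW : Module.finrank F W = r) :
    Nat.card {p : V →ₗ[F] W // Function.Surjective p} = injF (Fintype.card F) r n := by
  by_cases hr : r ≤ n
  · rw [← card_inj (F := F) (V := Module.Dual F V) r n (by simp [hV]) hr]
    let e : Module.Dual F W ≃ₗ[F] (Fin r → F) := LinearEquiv.ofFinrankEq _ _ (by simp [hW])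
    let T : (V →ₗ[F] W) → (Module.Dual F W →ₗ[F] Module.Dual F V) := fun p => p.dualMap
    have hTi : Function.Injective T := by
      intro p p' hp
      ext v
      rw [← sub_eq_zero, ← Module.forall_dual_apply_eq_zero_iff F]
      intro φ
      have := LinearMap.congr_fun (LinearMap.congr_fun hp φ) v
      simp only [T, LinearMap.dualMap_apply] at this
      rw [map_sub, this, sub_self]
    have : Finite (Module.Dual F W →ₗ[F] Module.Dual F V) := Module.finite_of_finite F
    have hTb : Function.Bijective T := by
      refine Function.Injective.bijective_of_nat_card_le hTi (le_of_eq ?_)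
      rw [Module.natCard_eq_pow_finrank (K := F), Module.natCard_eq_pow_finrank (K := F) (V := V →ₗ[F] W)]
      simp [Module.finrank_linearMap, mul_comm]
    let t : (V →ₗ[F] W) ≃ ((Fin r → F) →ₗ[F] Module.Dual F V) :=
      (Equiv.ofBijective T hTb).trans (e.arrowCongr (LinearEquiv.refl F _)).toEquiv
    refine Nat.card_congr (t.subtypeEquiv ?_)
    intro p
    rw [← LinearMap.dualMap_injective_iff]
    have : (t p : (Fin r → F) → Module.Dual F V) = p.dualMap ∘ e.symm := by
      ext v; rfl
    rw [this]
    exact (e.symm.toEquiv.injective_comp p.dualMap).symm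
  · rw [injF_eq_zero _ _ _ (by omega)]
    rw [Nat.card_eq_zero]
    left
    constructor
    rintro ⟨p, hp⟩
    have := LinearMap.finrank_le_finrank_of_surjective hp
    omega
end FF

namespace FF
set_option linter.unusedSectionVars false
set_option linter.unusedVariables false
variable {F : Type} [Field F] [Fintype F]

theorem card_sum_fib {X Y : Type} [Finite X] [Fintype Y] (f : X → Y) :
    Nat.card X = ∑ y : Y, Nat.card {x // f x = y} := by
  rw [← Nat.card_sigma]
  exact Nat.card_congr (Equiv.sigmaFiberEquiv f).symm

theorem card_fib {X Y : Type} [Finite X] [Finite Y] (f : X → Y) (c : ℕ)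
    (h : ∀ y, Nat.card {x // f x = y} = c) : Nat.card X = Nat.card Y * c := by
  have := Fintype.ofFinite Y
  rw [card_sum_fib f, Finset.sum_congr rfl (fun y _ => h y)]
  simp

theorem card_hom {V W : Type} [AddCommGroup V] [Module F V] [FiniteDimensional F V]
    [AddCommGroup W] [Module F W] [FiniteDimensional F W] :
    Nat.card (V →ₗ[F] W) = Fintype.card F ^ (Module.finrank F V * Module.finrank F W) := by
  rw [Module.natCard_eq_pow_finrank (K := F), Module.finrank_linearMap, Nat.card_eq_fintype_card]

theorem card_fiber_A {V W : Type} [AddCommGroup V] [Module F V] [FiniteDimensional F V]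
    [AddCommGroup W] [Module F W] [FiniteDimensional F W] (r a : ℕ)
    (hV : Module.finrank F V = r + a) (hW : Module.finrank F W = r)
    (j : W →ₗ[F] V) (p : V →ₗ[F] W) (hj : Function.Injective j) (hp : Function.Surjective p)
    (A' : Module.End F W) (hA : A' ∘ₗ (p ∘ₗ j) = (p ∘ₗ j) ∘ₗ A') :
    Nat.card {A : Module.End F V // A ∘ₗ j = j ∘ₗ A' ∧ p ∘ₗ A = A' ∘ₗ p} =
      Fintype.card F ^ (a * a) := by
  obtain ⟨l, hl⟩ := LinearMap.exists_leftInverse_of_injective j (LinearMap.ker_eq_bot.2 hj)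
  obtain ⟨s, hs⟩ := LinearMap.exists_rightInverse_of_surjective p (LinearMap.range_eq_top.2 hp)
  have hl' : ∀ x, l (j x) = x := fun x => LinearMap.congr_fun hl x
  have hs' : ∀ x, p (s x) = x := fun x => LinearMap.congr_fun hs x
  have hA' : ∀ x, A' (p (j x)) = p (j (A' x)) := fun x => LinearMap.congr_fun hA x
  let A0 : Module.End F V := j ∘ₗ A' ∘ₗ l + s ∘ₗ A' ∘ₗ p ∘ₗ (LinearMap.id - j ∘ₗ l)
  have h1 : ∀ x, A0 (j x) = j (A' x) := by intro x; simp [A0, hl']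
  have h2 : ∀ x, p (A0 x) = A' (p x) := by intro x; simp [A0, hs', hA']
  have hk : Module.finrank F (LinearMap.ker p) = a := by
    have := LinearMap.finrank_range_add_finrank_ker p
    rw [LinearMap.range_eq_top.2 hp, finrank_top] at this
    omega
  have hq : Module.finrank F (V ⧸ LinearMap.range j) = a := by
    have := Submodule.finrank_quotient_add_finrank (LinearMap.range j)
    rw [LinearMap.finrank_range_of_inj hj] at this
    omega
  have : Nat.card ((V ⧸ LinearMap.range j) →ₗ[F] LinearMap.ker p) = Fintype.card F ^ (a * a) := by
    rw [card_hom, hk, hq]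
  rw [← this]
  symm
  refine Nat.card_congr (Equiv.ofBijective (fun B =>
    ⟨A0 + (LinearMap.ker p).subtype ∘ₗ B ∘ₗ (LinearMap.range j).mkQ, ?_, ?_⟩) ⟨?_, ?_⟩)
  · ext x
    have : (LinearMap.range j).mkQ (j x) = 0 := by simp
    simp only [LinearMap.comp_apply, LinearMap.add_apply, this, h1]
    simp
  · ext x
    simp [h2]
  · intro B B' h
    simp only [Subtype.mk.injEq, add_right_inj] at h
    apply LinearMap.ext
    intro y
    obtain ⟨x, rfl⟩ := Submodule.mkQ_surjective _ y
    exact Subtype.ext (LinearMap.congr_fun h x)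
  · rintro ⟨A, hA1, hA2⟩
    have k1 : ∀ x, A (j x) = j (A' x) := fun x => LinearMap.congr_fun hA1 x
    have k2 : ∀ x, p (A x) = A' (p x) := fun x => LinearMap.congr_fun hA2 x
    refine ⟨(LinearMap.range j).liftQ ((A - A0).codRestrict (LinearMap.ker p) ?_) ?_, ?_⟩
    · intro x; simp [k2, h2]
    · rintro _ ⟨x, rfl⟩
      simp only [LinearMap.mem_ker]
      apply Subtype.ext
      simp [k1, h1]
    · apply Subtype.ext
      ext x
      simp

theorem card_fiber_phi {U W : Type} [AddCommGroup U] [Module F U] [FiniteDimensional F U]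
    [AddCommGroup W] [Module F W] [FiniteDimensional F W] (r a s : ℕ)
    (hU : Module.finrank F U = a) (hW : Module.finrank F W = r) (R : Submodule F W)
    (hR : Module.finrank F R = s) :
    Nat.card {φ : U →ₗ[F] W // Function.Surjective (R.mkQ ∘ₗ φ)} =
      injF (Fintype.card F) (r - s) a * Fintype.card F ^ (a * s) := by
  have hq : Module.finrank F (W ⧸ R) = r - s := by
    have := Submodule.finrank_quotient_add_finrank R
    omega
  rw [← card_surj (F := F) (V := U) (W := W ⧸ R) (r - s) a hU hq]
  have i1 : Finite (U →ₗ[F] W) := Module.finite_of_finite F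
  have i2 : Finite (U →ₗ[F] (W ⧸ R)) := Module.finite_of_finite F
  refine card_fib (fun φ => ⟨R.mkQ ∘ₗ φ.1, φ.2⟩) _ ?_
  rintro ⟨ψ, hψ⟩
  obtain ⟨t, ht⟩ := LinearMap.exists_rightInverse_of_surjective R.mkQ (by simp)
  have ht' : ∀ x, R.mkQ (t x) = x := fun x => LinearMap.congr_fun ht x
  have : Nat.card (U →ₗ[F] R) = Fintype.card F ^ (a * s) := by rw [card_hom, hU, hR]
  rw [← this]
  symm
  have key : ∀ B : U →ₗ[F] R, R.mkQ ∘ₗ (t ∘ₗ ψ + R.subtype ∘ₗ B) = ψ := by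
    intro B
    ext x
    rw [LinearMap.comp_apply, LinearMap.add_apply, map_add, LinearMap.comp_apply, ht']
    simp
  refine Nat.card_congr (Equiv.ofBijective (fun B =>
    ⟨⟨t ∘ₗ ψ + R.subtype ∘ₗ B, ?_⟩, ?_⟩) ⟨?_, ?_⟩)
  · rw [key]; exact hψ
  · exact Subtype.ext (key B)
  · intro B B' h
    simp only [Subtype.mk.injEq, add_right_inj] at h
    ext x
    exact LinearMap.congr_fun h x
  · rintro ⟨⟨φ, hφ⟩, h⟩
    have h' : ∀ x, R.mkQ (φ x) = ψ x := fun x => LinearMap.congr_fun (congrArg Subtype.val h) x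
    refine ⟨(φ - t ∘ₗ ψ).codRestrict R ?_, ?_⟩
    · intro x
      rw [← Submodule.Quotient.mk_eq_zero, ← Submodule.mkQ_apply]
      simp only [LinearMap.sub_apply, map_sub, LinearMap.comp_apply, ht']
      rw [h', sub_self]
    · apply Subtype.ext; apply Subtype.ext
      ext x
      simp

theorem card_fiber_p {V W : Type} [AddCommGroup V] [Module F V] [FiniteDimensional F V]
    [AddCommGroup W] [Module F W] [FiniteDimensional F W] (r a s : ℕ)
    (hV : Module.finrank F V = r + a) (hW : Module.finrank F W = r)
    (j : W →ₗ[F] V) (hj : Function.Injective j) (N : Module.End F W)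
    (hN : Module.finrank F (LinearMap.range N) = s) :
    Nat.card {p : V →ₗ[F] W // p ∘ₗ j = N ∧ Function.Surjective p} =
      injF (Fintype.card F) (r - s) a * Fintype.card F ^ (a * s) := by
  obtain ⟨U, hU⟩ := Submodule.exists_isCompl (LinearMap.range j)
  have hUa : Module.finrank F U = a := by
    have := Submodule.finrank_add_eq_of_isCompl hU
    rw [LinearMap.finrank_range_of_inj hj] at this
    omega
  rw [← card_fiber_phi (F := F) (U := U) (W := W) r a s hUa hW (LinearMap.range N) hN]
  let E : (W × U) ≃ₗ[F] V := ((LinearEquiv.ofInjective j hj).prodCongr (LinearEquiv.refl F U)).trans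
    (Submodule.prodEquivOfIsCompl _ _ hU)
  have hE : ∀ w u, E (w, u) = j w + u := by
    intro w u; simp [E]
  have hsurj : ∀ φ : U →ₗ[F] W, Function.Surjective (N.coprod φ) ↔
      Function.Surjective ((LinearMap.range N).mkQ ∘ₗ φ) := by
    intro φ
    constructor
    · intro h y
      obtain ⟨w, rfl⟩ := Submodule.mkQ_surjective _ y
      obtain ⟨⟨x, u⟩, rfl⟩ := h w
      refine ⟨u, ?_⟩
      have : (LinearMap.range N).mkQ (N x) = 0 := by simp
      rw [LinearMap.coprod_apply, map_add, this, zero_add]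
      rfl
    · intro h w
      obtain ⟨u, hu⟩ := h ((LinearMap.range N).mkQ w)
      have : w - φ u ∈ LinearMap.range N := by
        rw [← Submodule.Quotient.mk_eq_zero, ← Submodule.mkQ_apply, map_sub, ← hu]
        simp
      obtain ⟨x, hx⟩ := this
      exact ⟨(x, u), by simp [hx]⟩
  refine Nat.card_congr
    { toFun := fun p => ⟨p.1 ∘ₗ U.subtype, ?_⟩
      invFun := fun φ => ⟨(N.coprod φ.1) ∘ₗ E.symm.toLinearMap, ?_, ?_⟩
      left_inv := ?_
      right_inv := ?_ }
  · rw [← hsurj]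
    have : N.coprod (p.1 ∘ₗ U.subtype) = p.1 ∘ₗ E.toLinearMap := by
      apply LinearMap.ext
      rintro ⟨w, u⟩
      simp [hE, ← p.2.1]
    rw [this]
    exact p.2.2.comp E.surjective
  · ext w
    have : E.symm (j w) = (w, 0) := by rw [LinearEquiv.symm_apply_eq, hE]; simp
    simp [this]
  · exact ((hsurj _).2 φ.2).comp E.symm.surjective
  · rintro ⟨p, hp1, hp2⟩
    apply Subtype.ext
    apply LinearMap.ext
    intro v
    obtain ⟨⟨w, u⟩, rfl⟩ := E.surjective v
    change (N.coprod (p ∘ₗ U.subtype)) (E.symm (E (w, u))) = p (E (w, u))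
    rw [LinearEquiv.symm_apply_apply, hE]
    simp [← hp1]
  · rintro ⟨φ, hφ⟩
    apply Subtype.ext
    apply LinearMap.ext
    intro u
    have : E.symm (u : V) = (0, u) := by rw [LinearEquiv.symm_apply_eq, hE]; simp
    simp [this]

end FF

namespace FF
set_option linter.unusedSectionVars false
set_option linter.unusedVariables false
variable (F : Type) [Field F] [Fintype F]

/-- commuting pairs whose second member is killed by the `K`-th power -/
abbrev NilSet (K n : ℕ) : Type :=
  {P : Module.End F (Fin n → F) × Module.End F (Fin n → F) //
    P.1 * P.2 = P.2 * P.1 ∧ P.2 ^ K = 0}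

/-- the same with prescribed rank -/
abbrev NilRankSet (K n r : ℕ) : Type :=
  {P : Module.End F (Fin n → F) × Module.End F (Fin n → F) //
    P.1 * P.2 = P.2 * P.1 ∧ P.2 ^ K = 0 ∧ Module.finrank F (LinearMap.range P.2) = r}

noncomputable def nilRank (K n r : ℕ) : ℕ := Nat.card (NilRankSet F K n r)

/-- auxiliary set for the double count -/
abbrev Om (K n r : ℕ) : Type :=
  {w : ((Fin r → F) →ₗ[F] (Fin n → F)) × ((Fin n → F) →ₗ[F] (Fin r → F)) ×
      Module.End F (Fin n → F) × Module.End F (Fin r → F) //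
    Function.Injective w.1 ∧ Function.Surjective w.2.1 ∧
    w.2.2.1 ∘ₗ w.1 = w.1 ∘ₗ w.2.2.2 ∧ w.2.1 ∘ₗ w.2.2.1 = w.2.2.2 ∘ₗ w.2.1 ∧
    ((w.2.1 ∘ₗ w.1 : Module.End F (Fin r → F)) ^ K = 0)}

variable {F}

instance finHom (n m : ℕ) : Finite ((Fin n → F) →ₗ[F] (Fin m → F)) := Module.finite_of_finite F
instance finEnd (n : ℕ) : Finite (Module.End F (Fin n → F)) := Module.finite_of_finite F

theorem pow_comp {V W : Type} [AddCommGroup V] [Module F V] [AddCommGroup W] [Module F W]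
    (j : W →ₗ[F] V) (p : V →ₗ[F] W) (K : ℕ) (v : V) :
    ((j ∘ₗ p : Module.End F V) ^ (K + 1)) v = j (((p ∘ₗ j : Module.End F W) ^ K) (p v)) := by
  induction K generalizing v with
  | zero => simp
  | succ K ih => rw [pow_succ, Module.End.mul_apply, ih, pow_succ, Module.End.mul_apply]; rfl

theorem pow_comp_zero {V W : Type} [AddCommGroup V] [Module F V] [AddCommGroup W] [Module F W]
    (j : W →ₗ[F] V) (p : V →ₗ[F] W) (hj : Function.Injective j) (hp : Function.Surjective p)
    (K : ℕ) :
    (j ∘ₗ p : Module.End F V) ^ (K + 1) = 0 ↔ (p ∘ₗ j : Module.End F W) ^ K = 0 := by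
  constructor
  · intro h
    apply LinearMap.ext
    intro w
    obtain ⟨v, rfl⟩ := hp w
    apply hj
    rw [← pow_comp, h]; simp
  · intro h
    apply LinearMap.ext
    intro v
    rw [pow_comp, h]; simp

theorem card_Om_one (K n r : ℕ) : Nat.card (Om F K n r) = nilRank F (K + 1) n r * gl F r := by
  have key : Nat.card (Σ P : NilRankSet F (K + 1) n r, (Fin r → F) ≃ₗ[F] LinearMap.range P.1.2) =
      nilRank F (K + 1) n r * gl F r := by
    have := Fintype.ofFinite (NilRankSet F (K + 1) n r)
    have (P : NilRankSet F (K + 1) n r) : Finite ((Fin r → F) ≃ₗ[F] LinearMap.range P.1.2) :=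
      Finite.of_injective (fun e => (e : (Fin r → F) → LinearMap.range P.1.2)) DFunLike.coe_injective
    rw [Nat.card_sigma, Finset.sum_congr rfl
      (fun P _ => card_equiv_eq (F := F) (V := Fin r → F) (W := LinearMap.range P.1.2) r (by simp) P.2.2.2)]
    simp [nilRank]
  rw [← key]
  symm
  let jj : ∀ P : NilRankSet F (K + 1) n r, ((Fin r → F) ≃ₗ[F] LinearMap.range P.1.2) →
      ((Fin r → F) →ₗ[F] (Fin n → F)) := fun P e => (LinearMap.range P.1.2).subtype ∘ₗ e.toLinearMap
  let pp : ∀ P : NilRankSet F (K + 1) n r, ((Fin r → F) ≃ₗ[F] LinearMap.range P.1.2) →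
      ((Fin n → F) →ₗ[F] (Fin r → F)) := fun P e => e.symm.toLinearMap ∘ₗ P.1.2.rangeRestrict
  have hinv : ∀ P : NilRankSet F (K + 1) n r, ∀ x ∈ LinearMap.range P.1.2,
      P.1.1 x ∈ LinearMap.range P.1.2 := by
    rintro P _ ⟨x, rfl⟩
    exact ⟨P.1.1 x, (LinearMap.congr_fun P.2.1 x).symm⟩
  let aa : ∀ P : NilRankSet F (K + 1) n r, ((Fin r → F) ≃ₗ[F] LinearMap.range P.1.2) →
      Module.End F (Fin r → F) := fun P e =>
        e.symm.toLinearMap ∘ₗ (P.1.1.restrict (hinv P)) ∘ₗ e.toLinearMap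
  have hj : ∀ P e, Function.Injective (jj P e) := by
    intro P e
    exact (Subtype.val_injective).comp e.injective
  have hp : ∀ P e, Function.Surjective (pp P e) := by
    intro P e
    exact e.symm.surjective.comp P.1.2.surjective_rangeRestrict
  have hjp : ∀ P e, (jj P e) ∘ₗ (pp P e) = P.1.2 := by
    intro P e
    apply LinearMap.ext
    intro x
    simp [jj, pp]
  have haj : ∀ P e, P.1.1 ∘ₗ jj P e = jj P e ∘ₗ aa P e := by
    intro P e
    apply LinearMap.ext
    intro v
    simp [jj, aa]
  refine Nat.card_congr (Equiv.ofBijective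
    (fun x => ⟨(jj x.1 x.2, pp x.1 x.2, x.1.1.1, aa x.1 x.2), hj _ _, hp _ _, ?_, ?_, ?_⟩) ⟨?_, ?_⟩)
  · exact haj _ _
  · apply LinearMap.ext
    intro v
    apply x.2.injective
    apply Subtype.ext
    have := LinearMap.congr_fun x.1.2.1 v
    simp only [Module.End.mul_apply] at this
    simp [pp, aa, this]
  · exact (pow_comp_zero _ _ (hj _ _) (hp _ _) K).1 ((hjp x.1 x.2).symm ▸ x.1.2.2.1)
  · rintro ⟨P, e⟩ ⟨P', e'⟩ h
    simp only [Subtype.mk.injEq, Prod.mk.injEq] at h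
    obtain ⟨h1, h2, h3, h4⟩ := h
    have hP : P = P' := by
      apply Subtype.ext
      refine Prod.ext h3 ?_
      rw [← hjp P e, ← hjp P' e', h1, h2]
    subst hP
    have : e = e' := by
      ext1 v
      apply Subtype.ext
      exact LinearMap.congr_fun h1 v
    rw [this]
  · rintro ⟨⟨j, p, A, A'⟩, h1, h2, h3, h4, h5⟩
    simp only at h1 h2 h3 h4 h5
    have hr : LinearMap.range j = LinearMap.range (j ∘ₗ p : Module.End F (Fin n → F)) := by
      rw [LinearMap.range_comp, LinearMap.range_eq_top.2 h2, Submodule.map_top]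
    let P : NilRankSet F (K + 1) n r := ⟨(A, j ∘ₗ p), by
      change A ∘ₗ (j ∘ₗ p) = (j ∘ₗ p) ∘ₗ A
      rw [← LinearMap.comp_assoc, h3, LinearMap.comp_assoc, LinearMap.comp_assoc, h4],
      (pow_comp_zero j p h1 h2 K).2 h5, by
      change Module.finrank F (LinearMap.range (j ∘ₗ p : Module.End F (Fin n → F))) = r
      rw [← hr, LinearMap.finrank_range_of_inj h1]; simp⟩
    let e : (Fin r → F) ≃ₗ[F] LinearMap.range P.1.2 :=
      (LinearEquiv.ofInjective j h1).trans (LinearEquiv.ofEq _ _ hr)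
    have he : ∀ v, (e v : Fin n → F) = j v := fun v => rfl
    refine ⟨⟨P, e⟩, ?_⟩
    apply Subtype.ext
    refine Prod.ext ?_ (Prod.ext ?_ (Prod.ext rfl ?_))
    · apply LinearMap.ext; intro v; exact he v
    · apply LinearMap.ext; intro v
      apply e.injective
      apply Subtype.ext
      rw [he (p v)]
      change ((e (e.symm (P.1.2.rangeRestrict v)) : LinearMap.range P.1.2) : Fin n → F) = _
      rw [LinearEquiv.apply_symm_apply]
      rfl
    · apply LinearMap.ext; intro v
      have hjj : jj P e = j := by apply LinearMap.ext; intro v; exact he v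
      have h := haj P e
      rw [hjj] at h
      apply h1
      exact (LinearMap.congr_fun h v).symm.trans (LinearMap.congr_fun h3 v)

theorem card_Om_two (K r a : ℕ) : Nat.card (Om F K (r + a) r) =
    injF (Fintype.card F) r (r + a) * (∑ s ∈ Finset.range (r + 1), nilRank F K r s *
      (injF (Fintype.card F) (r - s) a * Fintype.card F ^ (a * s))) * Fintype.card F ^ (a * a) := by
  let n := r + a
  let Om1 : Type := {w : ((Fin r → F) →ₗ[F] (Fin n → F)) × ((Fin n → F) →ₗ[F] (Fin r → F)) ×
       Module.End F (Fin r → F) // Function.Injective w.1 ∧ Function.Surjective w.2.1 ∧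
       w.2.2 ∘ₗ (w.2.1 ∘ₗ w.1) = (w.2.1 ∘ₗ w.1) ∘ₗ w.2.2 ∧
       ((w.2.1 ∘ₗ w.1 : Module.End F (Fin r → F)) ^ K = 0)}
  have i1 : Finite Om1 := Subtype.finite
  have s1 : Nat.card (Om F K n r) = Nat.card Om1 * Fintype.card F ^ (a * a) := by
    refine card_fib (fun w => (⟨(w.1.1, w.1.2.1, w.1.2.2.2), w.2.1, w.2.2.1, ?_, w.2.2.2.2.2⟩ : Om1)) _ ?_
    · have h3 := w.2.2.2.1
      have h4 := w.2.2.2.2.1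
      simp only
      rw [← LinearMap.comp_assoc, ← h4, LinearMap.comp_assoc, h3, LinearMap.comp_assoc]
    · rintro ⟨⟨j, p, A'⟩, h1, h2, h3, h4⟩
      simp only at h1 h2 h3 h4
      rw [← card_fiber_A (F := F) (V := Fin n → F) (W := Fin r → F) r a (by simp [n]) (by simp)
        j p h1 h2 A' h3]
      refine Nat.card_congr
        { toFun := fun w => ⟨w.1.1.2.2.1, ?_⟩
          invFun := fun A => ⟨⟨(j, p, A.1, A'), h1, h2, A.2.1, A.2.2, h4⟩, rfl⟩
          left_inv := ?_
          right_inv := fun A => rfl }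
      · obtain ⟨⟨⟨j0, p0, A, A0⟩, k1, k2, k3, k4, k5⟩, hw⟩ := w
        simp only [Subtype.mk.injEq, Prod.mk.injEq] at hw
        obtain ⟨rfl, rfl, rfl⟩ := hw
        exact ⟨k3, k4⟩
      · rintro ⟨⟨⟨j0, p0, A, A0⟩, k1, k2, k3, k4, k5⟩, hw⟩
        simp only [Subtype.mk.injEq, Prod.mk.injEq] at hw
        obtain ⟨rfl, rfl, rfl⟩ := hw
        rfl
  have s2 : Nat.card Om1 = injF (Fintype.card F) r n * (∑ s ∈ Finset.range (r + 1), nilRank F K r s *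
      (injF (Fintype.card F) (r - s) a * Fintype.card F ^ (a * s))) := by
    have := Fintype.ofFinite {j : (Fin r → F) →ₗ[F] (Fin n → F) // Function.Injective j}
    have := Fintype.ofFinite (NilSet F K r)
    let f : Om1 → {j : (Fin r → F) →ₗ[F] (Fin n → F) // Function.Injective j} × NilSet F K r :=
      fun w => (⟨w.1.1, w.2.1⟩, ⟨(w.1.2.2, w.1.2.1 ∘ₗ w.1.1), w.2.2.2.1, w.2.2.2.2⟩)
    let g : NilSet F K r → ℕ := fun P =>
        injF (Fintype.card F) (r - Module.finrank F (LinearMap.range P.1.2)) a *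
          Fintype.card F ^ (a * Module.finrank F (LinearMap.range P.1.2))
    have hf : ∀ y, Nat.card {x // f x = y} = g y.2 := by
      rintro ⟨⟨j, hj⟩, ⟨⟨A', N⟩, hP1, hP2⟩⟩
      simp only [g]
      rw [← card_fiber_p (F := F) (V := Fin n → F) (W := Fin r → F) r a _ (by simp [n]) (by simp)
        j hj N rfl]
      refine Nat.card_congr
        { toFun := fun w => ⟨w.1.1.2.1, ?_⟩
          invFun := fun p => ⟨⟨(j, p.1, A'), hj, p.2.2, ?_, ?_⟩, ?_⟩
          left_inv := ?_
          right_inv := fun A => rfl }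
      · obtain ⟨⟨⟨j0, p0, A0⟩, k1, k2, k3, k4⟩, hw⟩ := w
        simp only [f, Prod.mk.injEq, Subtype.mk.injEq] at hw
        obtain ⟨rfl, rfl, rfl⟩ := hw
        exact ⟨rfl, k2⟩
      · simp only [p.2.1]; exact hP1
      · simp only [p.2.1]; exact hP2
      · simp only [f, Prod.mk.injEq, Subtype.mk.injEq]
        exact ⟨trivial, trivial, p.2.1⟩
      · rintro ⟨⟨⟨j0, p0, A0⟩, k1, k2, k3, k4⟩, hw⟩
        simp only [f, Prod.mk.injEq, Subtype.mk.injEq] at hw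
        obtain ⟨rfl, rfl, rfl⟩ := hw
        rfl
    rw [card_sum_fib f, Finset.sum_congr rfl (fun y _ => hf y), Fintype.sum_prod_type]
    simp only
    rw [Finset.sum_const, Finset.card_univ, smul_eq_mul]
    rw [← Nat.card_eq_fintype_card, card_inj (F := F) (V := Fin n → F) r n (by simp) (by simp [n])]
    congr 1
    have hmem : ∀ P ∈ (Finset.univ : Finset (NilSet F K r)),
        Module.finrank F (LinearMap.range P.1.2) ∈ Finset.range (r + 1) := by
      intro P _
      rw [Finset.mem_range, Nat.lt_succ_iff]
      simpa using Submodule.finrank_le (LinearMap.range P.1.2)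
    rw [← Finset.sum_fiberwise_of_maps_to hmem]
    refine Finset.sum_congr rfl fun s _ => ?_
    rw [Finset.sum_congr rfl (g := fun _ =>
      (injF (Fintype.card F) (r - s) a * Fintype.card F ^ (a * s)))]
    · rw [Finset.sum_const, smul_eq_mul]
      congr 1
      rw [nilRank, ← Fintype.card_subtype, ← Nat.card_eq_fintype_card]
      exact Nat.card_congr
        { toFun := fun P => ⟨P.1.1, P.1.2.1, P.1.2.2, P.2⟩
          invFun := fun P => ⟨⟨P.1, P.2.1, P.2.2.1⟩, P.2.2.2⟩
          left_inv := fun P => rfl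
          right_inv := fun P => rfl }
    · intro P hP
      rw [Finset.mem_filter] at hP
      simp only [g]
      rw [hP.2]
  rw [s1, s2]

end FF

namespace FF
set_option linter.unusedSectionVars false
set_option linter.unusedVariables false
open scoped ENNReal NNReal
variable (F : Type) [Field F] [Fintype F]

/-- the number of commuting pairs with nilpotent second member -/
noncomputable def nilPairs (n : ℕ) : ℕ :=
  Nat.card {P : Module.End F (Fin n → F) × Module.End F (Fin n → F) //
    P.1 * P.2 = P.2 * P.1 ∧ IsNilpotent P.2}

noncomputable def invphi (m : ℕ) : ℝ≥0 := (Fintype.card F : ℝ≥0) ^ (m * m) / gl F m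

noncomputable def QQ (K a r : ℕ) : ℝ≥0 := (nilRank F K (r + a) r : ℝ≥0) / gl F (r + a)

noncomputable def xx : ℝ≥0 := (Fintype.card F : ℝ≥0)⁻¹

variable {F}

theorem gl_ne (n : ℕ) : (gl F n : ℝ≥0) ≠ 0 := by exact_mod_cast (gl_pos (F := F) n).ne'

theorem q_ne : (Fintype.card F : ℝ≥0) ≠ 0 := by exact_mod_cast Fintype.card_ne_zero

theorem injF_cast (r a : ℕ) : (injF (Fintype.card F) r (r + a) : ℝ≥0) =
    gl F (r + a) / ((Fintype.card F : ℝ≥0) ^ (r * a) * gl F a) := by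
  rw [eq_div_iff (mul_ne_zero (pow_ne_zero _ q_ne) (gl_ne a)), gl_eq, gl_eq, ← injF_mul]
  push_cast
  ring

theorem QQ_succ (K a r : ℕ) : QQ F (K + 1) a r = ∑ st ∈ Finset.HasAntidiagonal.antidiagonal r,
    QQ F K st.2 st.1 * (if st.2 ≤ a then invphi F (a - st.2) else 0) := by
  have h := (card_Om_one (F := F) K (r + a) r).symm.trans (card_Om_two K r a)
  have h' : (nilRank F (K + 1) (r + a) r : ℝ≥0) * gl F r =
      (injF (Fintype.card F) r (r + a) : ℝ≥0) * (∑ s ∈ Finset.range (r + 1), (nilRank F K r s : ℝ≥0) *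
      ((injF (Fintype.card F) (r - s) a : ℝ≥0) * (Fintype.card F : ℝ≥0) ^ (a * s))) *
        (Fintype.card F : ℝ≥0) ^ (a * a) := by
    exact_mod_cast h
  rw [QQ, div_eq_iff (gl_ne _), ← mul_left_inj' (gl_ne (F := F) r), h', injF_cast,
    Finset.Nat.sum_antidiagonal_eq_sum_range_succ_mk]
  rw [Finset.mul_sum, Finset.sum_mul, Finset.sum_mul, Finset.sum_mul]
  refine Finset.sum_congr rfl fun s hs => ?_
  have hsr : s ≤ r := by rw [Finset.mem_range] at hs; omega
  obtain ⟨b, rfl⟩ := Nat.exists_eq_add_of_le hsr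
  simp only [Nat.add_sub_cancel_left]
  split_ifs with hb
  · obtain ⟨c, rfl⟩ := Nat.exists_eq_add_of_le hb
    rw [injF_cast, QQ, invphi]
    simp only [Nat.add_sub_cancel_left]
    have := q_ne (F := F)
    have h1 := gl_ne (F := F) (s + b + (b + c))
    have h2 := gl_ne (F := F) (b + c)
    have h3 := gl_ne (F := F) c
    have h4 := gl_ne (F := F) (s + b)
    field_simp
    ring
  · rw [injF_eq_zero _ b a (by omega)]
    simp

noncomputable def Fz (F : Type) [Field F] [Fintype F] (z : ℝ≥0∞) : ℝ≥0∞ :=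
  ∑' m : ℕ, (invphi F m : ℝ≥0∞) * z ^ m

noncomputable def HH (F : Type) [Field F] [Fintype F] (K : ℕ) (z : ℝ≥0∞) : ℝ≥0∞ :=
  ∑' a : ℕ, ∑' r : ℕ, (QQ F K a r : ℝ≥0∞) * (xx F : ℝ≥0∞) ^ (r + a) * z ^ a

theorem tsum_anti (f : ℕ × ℕ → ℝ≥0∞) :
    ∑' n : ℕ, ∑ p ∈ Finset.HasAntidiagonal.antidiagonal n, f p = ∑' a : ℕ, ∑' b : ℕ, f (a, b) := by
  rw [← ENNReal.tsum_prod, ← Finset.HasAntidiagonal.sigmaAntidiagonalEquivProd.tsum_eq, ENNReal.tsum_sigma']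
  refine tsum_congr fun n => ?_
  rw [← Finset.tsum_subtype]
  rfl

theorem tsum_shift (b : ℕ) (h : ℕ → ℝ≥0∞) :
    ∑' a : ℕ, (if b ≤ a then h a else 0) = ∑' c : ℕ, h (b + c) := by
  have hi : Function.Injective (fun c : ℕ => b + c) := fun c d h => by simpa using h
  rw [← hi.tsum_eq]
  · simp
  · intro a ha
    simp only [Function.mem_support, ne_eq, ite_eq_right_iff, Classical.not_imp] at ha
    exact ⟨a - b, by simp; omega⟩

theorem HH_succ (K : ℕ) (z : ℝ≥0∞) :
    HH F (K + 1) z = HH F K (xx F * z) * Fz F (xx F * z) := by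
  have e1 : HH F (K + 1) z = ∑' s : ℕ, ∑' b : ℕ, ∑' c : ℕ,
      (QQ F K b s : ℝ≥0∞) * invphi F c * (xx F : ℝ≥0∞) ^ (s + b + (b + c)) * z ^ (b + c) := by
    unfold HH
    have : ∀ a : ℕ, ∑' r : ℕ, (QQ F (K + 1) a r : ℝ≥0∞) * (xx F : ℝ≥0∞) ^ (r + a) * z ^ a =
        ∑' s : ℕ, ∑' b : ℕ, (if b ≤ a then (QQ F K b s : ℝ≥0∞) * invphi F (a - b) *
          (xx F : ℝ≥0∞) ^ (s + b + a) * z ^ a else 0) := by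
      intro a
      rw [← tsum_anti (fun p => if p.2 ≤ a then (QQ F K p.2 p.1 : ℝ≥0∞) * invphi F (a - p.2) *
          (xx F : ℝ≥0∞) ^ (p.1 + p.2 + a) * z ^ a else 0)]
      refine tsum_congr fun r => ?_
      rw [QQ_succ, ENNReal.ofNNReal_finsetSum, Finset.sum_mul, Finset.sum_mul]
      refine Finset.sum_congr rfl fun p hp => ?_
      rw [Finset.HasAntidiagonal.mem_antidiagonal] at hp
      rw [hp]
      split_ifs <;> simp
    rw [tsum_congr this, ENNReal.tsum_comm]
    refine tsum_congr fun s => ?_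
    rw [ENNReal.tsum_comm]
    refine tsum_congr fun b => ?_
    rw [tsum_shift b]
    simp
  rw [e1]
  unfold HH Fz
  rw [← ENNReal.tsum_mul_right, ENNReal.tsum_comm]
  refine tsum_congr fun b => ?_
  rw [← ENNReal.tsum_mul_right]
  refine tsum_congr fun s => ?_
  rw [← ENNReal.tsum_mul_left]
  refine tsum_congr fun c => ?_
  rw [mul_pow, mul_pow]
  ring

theorem nilRank_zero_zero : nilRank F 0 0 0 = 1 := by
  rw [nilRank, Nat.card_eq_one_iff_unique]
  refine ⟨⟨fun a b => Subtype.ext (Subsingleton.elim _ _)⟩, ⟨⟨0, ?_, ?_, ?_⟩⟩⟩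
  · rfl
  · exact Subsingleton.elim _ _
  · rw [← Nat.le_zero]
    simpa using Submodule.finrank_le (LinearMap.range (0 : Module.End F (Fin 0 → F)))

theorem nilRank_zero (n r : ℕ) (h : n ≠ 0) : nilRank F 0 n r = 0 := by
  rw [nilRank, Nat.card_eq_zero]
  left
  constructor
  rintro ⟨P, h1, h2, h3⟩
  have : Nonempty (Fin n) := ⟨⟨0, by omega⟩⟩
  simp at h2

theorem HH_zero (z : ℝ≥0∞) : HH F 0 z = 1 := by
  unfold HH
  have h0 : ∀ a r, (a ≠ 0 ∨ r ≠ 0) → QQ F 0 a r = 0 := by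
    intro a r h
    rw [QQ, nilRank_zero _ _ (by omega)]; simp
  rw [tsum_eq_single 0, tsum_eq_single 0]
  · have : gl F 0 = 1 := by rw [gl_eq]; simp [injF]
    simp [QQ, nilRank_zero_zero, this]
  · intro r hr; rw [h0 _ _ (Or.inr hr)]; simp
  · intro a ha
    rw [ENNReal.tsum_eq_zero]
    intro r; rw [h0 _ _ (Or.inl ha)]; simp

theorem HH_eq (K i : ℕ) : HH F K ((xx F : ℝ≥0∞) ^ i) =
    ∏ t ∈ Finset.range K, Fz F ((xx F : ℝ≥0∞) ^ (i + t + 1)) := by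
  induction K generalizing i with
  | zero => simp [HH_zero]
  | succ K ih =>
    rw [HH_succ, ← pow_succ', ih, Finset.prod_range_succ']
    congr 1
    refine Finset.prod_congr rfl fun t _ => ?_
    congr 2
    ring

theorem HH_one (K : ℕ) : HH F K 1 = ∑' n : ℕ,
    ((∑ r ∈ Finset.range (n + 1), nilRank F K n r : ℕ) / gl F n : ℝ≥0) * (xx F : ℝ≥0∞) ^ n := by
  unfold HH
  rw [ENNReal.tsum_comm]
  simp only [one_pow, mul_one]
  rw [← tsum_anti (fun p => (QQ F K p.2 p.1 : ℝ≥0∞) * (xx F : ℝ≥0∞) ^ (p.1 + p.2))]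
  refine tsum_congr fun n => ?_
  rw [Nat.cast_sum, Finset.sum_div, ENNReal.ofNNReal_finsetSum, Finset.sum_mul,
    ← Finset.Nat.sum_antidiagonal_eq_sum_range_succ (fun r a =>
      (((nilRank F K n r : ℝ≥0) / gl F n : ℝ≥0) : ℝ≥0∞) * (xx F : ℝ≥0∞) ^ n)]
  refine Finset.sum_congr rfl fun p hp => ?_
  rw [Finset.HasAntidiagonal.mem_antidiagonal] at hp
  rw [QQ, hp]

theorem sum_nilRank (K n : ℕ) : ∑ r ∈ Finset.range (n + 1), nilRank F K n r =
    Nat.card (NilSet F K n) := by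
  have := Fintype.ofFinite (NilSet F K n)
  let f : NilSet F K n → Fin (n + 1) := fun P => ⟨Module.finrank F (LinearMap.range P.1.2), by
    rw [Nat.lt_succ_iff]
    simpa using Submodule.finrank_le (LinearMap.range P.1.2)⟩
  rw [card_sum_fib f, Finset.sum_range]
  refine Finset.sum_congr rfl fun r _ => ?_
  rw [nilRank]
  refine Nat.card_congr
    { toFun := fun P => ⟨⟨P.1, P.2.1, P.2.2.1⟩, Fin.ext P.2.2.2⟩
      invFun := fun P => ⟨P.1.1, P.1.2.1, P.1.2.2, congrArg Fin.val P.2⟩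
      left_inv := fun P => rfl
      right_inv := fun P => rfl }

theorem nilSet_le (K n : ℕ) : Nat.card (NilSet F K n) ≤ nilPairs F n := by
  apply Nat.card_le_card_of_injective (fun P : NilSet F K n =>
    (⟨P.1, P.2.1, ⟨K, P.2.2⟩⟩ : {P : Module.End F (Fin n → F) × Module.End F (Fin n → F) //
    P.1 * P.2 = P.2 * P.1 ∧ IsNilpotent P.2}))
  intro P P' h
  exact Subtype.ext (by simpa using h)

theorem nilSet_eq (K n : ℕ) (h : n ≤ K) : Nat.card (NilSet F K n) = nilPairs F n := by
  apply le_antisymm (nilSet_le K n)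
  have key : ∀ N : Module.End F (Fin n → F), IsNilpotent N → N ^ K = 0 := by
    intro N hN
    have h1 : N ^ n = 0 := by
      have h2 := (LinearMap.isNilpotent_iff_charpoly N).1 hN
      have h3 := LinearMap.aeval_self_charpoly N
      rw [h2] at h3
      simpa using h3
    exact pow_eq_zero_of_le h h1
  apply Nat.card_le_card_of_injective (fun P : {P : Module.End F (Fin n → F) × Module.End F (Fin n → F) //
    P.1 * P.2 = P.2 * P.1 ∧ IsNilpotent P.2} => (⟨P.1, P.2.1, key _ P.2.2⟩ : NilSet F K n))
  intro P P' h
  exact Subtype.ext (by simpa using h)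

/-- normalized generating coefficients -/
noncomputable def nu (F : Type) [Field F] [Fintype F] (n : ℕ) : ℝ≥0 := nilPairs F n / gl F n

theorem tendsto_nu : Filter.Tendsto
    (fun K => ∏ t ∈ Finset.range K, Fz F ((xx F : ℝ≥0∞) ^ (t + 1))) Filter.atTop
    (nhds (∑' n : ℕ, (nu F n : ℝ≥0∞) * (xx F : ℝ≥0∞) ^ n)) := by
  have hH : ∀ K, ∏ t ∈ Finset.range K, Fz F ((xx F : ℝ≥0∞) ^ (t + 1)) = HH F K 1 := by
    intro K
    have := HH_eq (F := F) K 0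
    rw [pow_zero] at this
    rw [this]
    simp
  simp only [hH]
  refine tendsto_of_tendsto_of_tendsto_of_le_of_le
    (ENNReal.tendsto_nat_tsum (fun n => (nu F n : ℝ≥0∞) * (xx F : ℝ≥0∞) ^ n))
    tendsto_const_nhds ?_ ?_
  · intro K
    simp only
    rw [HH_one]
    refine le_trans (le_of_eq ?_) (ENNReal.sum_le_tsum (Finset.range K))
    refine Finset.sum_congr rfl fun n hn => ?_
    rw [Finset.mem_range] at hn
    rw [sum_nilRank, nilSet_eq K n hn.le, nu]
  · intro K
    simp only
    rw [HH_one]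
    refine ENNReal.tsum_le_tsum fun n => ?_
    rw [sum_nilRank, nu]
    gcongr
    exact nilSet_le K n

end FF

namespace FF
set_option linter.unusedSectionVars false
set_option linter.unusedVariables false
open scoped ENNReal NNReal
variable (F : Type) [Field F] [Fintype F]

abbrev NilP (n : ℕ) : Type := {P : Module.End F (Fin n → F) × Module.End F (Fin n → F) //
    P.1 * P.2 = P.2 * P.1 ∧ IsNilpotent P.2}

abbrev InvP (n : ℕ) : Type := {P : Module.End F (Fin n → F) × Module.End F (Fin n → F) //
    P.1 * P.2 = P.2 * P.1 ∧ IsUnit P.2}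

noncomputable def invPairs (n : ℕ) : ℕ := Nat.card (InvP F n)

/-- commuting pairs, with the dimension of the Fitting null component fixed -/
abbrev FitP (n k : ℕ) : Type := {P : Module.End F (Fin n → F) × Module.End F (Fin n → F) //
    P.1 * P.2 = P.2 * P.1 ∧ Module.finrank F (LinearMap.ker (P.2 ^ (n + 1))) = k}

abbrev AllP (n : ℕ) : Type := {P : Module.End F (Fin n → F) × Module.End F (Fin n → F) //
    P.1 * P.2 = P.2 * P.1}

variable {F}

theorem fitting_isCompl {V : Type} [AddCommGroup V] [Module F V] [FiniteDimensional F V]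
    (M : ℕ) (hM : Module.finrank F V ≤ M) (B : Module.End F V) :
    IsCompl (LinearMap.ker (B ^ M)) (LinearMap.range (B ^ M)) := by
  have hk : LinearMap.ker (B ^ (M + M)) = LinearMap.ker (B ^ M) := by
    rw [Module.End.ker_pow_eq_ker_pow_finrank_of_le (by omega : Module.finrank F V ≤ M + M),
      Module.End.ker_pow_eq_ker_pow_finrank_of_le hM]
  have hd : Disjoint (LinearMap.ker (B ^ M)) (LinearMap.range (B ^ M)) := by
    rw [Submodule.disjoint_def]
    rintro _ h ⟨x, rfl⟩
    have : x ∈ LinearMap.ker (B ^ (M + M)) := by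
      rw [LinearMap.mem_ker, pow_add, Module.End.mul_apply]; exact h
    rw [hk] at this
    exact this
  refine ⟨hd, ?_⟩
  rw [codisjoint_iff]
  apply Submodule.eq_top_of_disjoint _ _ _ hd
  rw [add_comm]
  exact (LinearMap.finrank_range_add_finrank_ker (B ^ M)).ge

theorem commute_pow {V : Type} [AddCommGroup V] [Module F V] (A B : Module.End F V)
    (h : A * B = B * A) (M : ℕ) (x : V) : A ((B ^ M) x) = (B ^ M) (A x) := by
  have : Commute A (B ^ M) := Commute.pow_right h M
  exact LinearMap.congr_fun this.eq x

theorem inv_ker {V : Type} [AddCommGroup V] [Module F V] (A B : Module.End F V)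
    (h : A * B = B * A) (M : ℕ) : ∀ x ∈ LinearMap.ker (B ^ M), A x ∈ LinearMap.ker (B ^ M) := by
  intro x hx
  rw [LinearMap.mem_ker] at *
  rw [← commute_pow A B h, hx, map_zero]

theorem inv_range {V : Type} [AddCommGroup V] [Module F V] (A B : Module.End F V)
    (h : A * B = B * A) (M : ℕ) : ∀ x ∈ LinearMap.range (B ^ M), A x ∈ LinearMap.range (B ^ M) := by
  rintro _ ⟨x, rfl⟩
  exact ⟨A x, (commute_pow A B h M x).symm⟩

theorem restrict_nil {V : Type} [AddCommGroup V] [Module F V] (B : Module.End F V) (M : ℕ) :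
    IsNilpotent (B.restrict (inv_ker B B rfl M)) := by
  refine ⟨M, ?_⟩
  apply LinearMap.ext
  rintro ⟨x, hx⟩
  apply Subtype.ext
  rw [Module.End.pow_restrict]
  simpa using hx

theorem restrict_unit {V : Type} [AddCommGroup V] [Module F V] [FiniteDimensional F V]
    (B : Module.End F V) (M : ℕ) (hM : Module.finrank F V ≤ M) (h0 : M ≠ 0) :
    IsUnit (B.restrict (inv_range B B rfl M)) := by
  rw [LinearMap.isUnit_iff_ker_eq_bot, LinearMap.ker_eq_bot']
  rintro ⟨x, hx⟩ h
  have h' : B x = 0 := congrArg Subtype.val h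
  apply Subtype.ext
  refine (Submodule.disjoint_def.1 (fitting_isCompl M hM B).disjoint) x ?_ hx
  obtain ⟨m, rfl⟩ := Nat.exists_eq_succ_of_ne_zero h0
  rw [LinearMap.mem_ker, pow_succ, Module.End.mul_apply, h', map_zero]

theorem restrict_comm {V : Type} [AddCommGroup V] [Module F V] (A B : Module.End F V)
    (U : Submodule F V) (hA : ∀ x ∈ U, A x ∈ U) (hB : ∀ x ∈ U, B x ∈ U) (h : A * B = B * A) :
    A.restrict hA * B.restrict hB = B.restrict hB * A.restrict hA := by
  apply LinearMap.ext
  intro x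
  apply Subtype.ext
  exact LinearMap.congr_fun h x

section
variable {V W : Type} [AddCommGroup V] [Module F V] [AddCommGroup W] [Module F W]

/-- conjugation -/
def cj (e : W ≃ₗ[F] V) (A : Module.End F V) : Module.End F W :=
  e.symm.toLinearMap ∘ₗ A ∘ₗ e.toLinearMap

theorem cj_apply (e : W ≃ₗ[F] V) (A : Module.End F V) (x : W) : cj e A x = e.symm (A (e x)) := rfl

theorem cj_mul (e : W ≃ₗ[F] V) (A B : Module.End F V) : cj e (A * B) = cj e A * cj e B := by
  apply LinearMap.ext; intro x; simp [cj]

theorem cj_pow (e : W ≃ₗ[F] V) (A : Module.End F V) (n : ℕ) : cj e (A ^ n) = cj e A ^ n := by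
  induction n with
  | zero => apply LinearMap.ext; intro x; simp [cj]
  | succ n ih => rw [pow_succ, cj_mul, ih, pow_succ]

theorem cj_nil (e : W ≃ₗ[F] V) (A : Module.End F V) (h : IsNilpotent A) : IsNilpotent (cj e A) := by
  obtain ⟨n, hn⟩ := h
  refine ⟨n, ?_⟩
  rw [← cj_pow, hn]
  apply LinearMap.ext; intro x; simp [cj]

theorem cj_unit (e : W ≃ₗ[F] V) (A : Module.End F V) (h : IsUnit A) : IsUnit (cj e A) := by
  rw [Module.End.isUnit_iff] at *
  exact (e.symm.bijective.comp h).comp e.bijective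
end

theorem finite_equiv (V W : Type) [AddCommGroup V] [Module F V] [AddCommGroup W] [Module F W]
    [FiniteDimensional F V] [FiniteDimensional F W] : Finite (V ≃ₗ[F] W) := by
  have : Finite V := Module.finite_of_finite F
  have : Finite W := Module.finite_of_finite F
  exact Finite.of_injective (fun e => (e : V → W)) DFunLike.coe_injective

theorem fit_card (k l : ℕ) : Nat.card (FitP F (k + l) k) * (gl F k * gl F l) =
    gl F (k + l) * (nilPairs F k * invPairs F l) := by
  set n := k + l with hn
  let U : FitP F n k → Submodule F (Fin n → F) := fun P => LinearMap.ker (P.1.2 ^ (n + 1))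
  let W : FitP F n k → Submodule F (Fin n → F) := fun P => LinearMap.range (P.1.2 ^ (n + 1))
  have hUW : ∀ P, IsCompl (U P) (W P) := fun P => fitting_isCompl _ (by simp) _
  have hW : ∀ P, Module.finrank F (W P) = l := by
    intro P
    have := LinearMap.finrank_range_add_finrank_ker (P.1.2 ^ (n + 1))
    rw [P.2.2] at this
    simp only [Module.finrank_fintype_fun_eq_card, Fintype.card_fin] at this
    have h2 : Module.finrank F (W P) + k = n := this
    omega
  let S : FitP F n k → Type := fun P => ((Fin k → F) ≃ₗ[F] U P) × ((Fin l → F) ≃ₗ[F] W P)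
  have key : Nat.card (Σ P : FitP F n k, S P) = Nat.card (FitP F n k) * (gl F k * gl F l) := by
    have := Fintype.ofFinite (FitP F n k)
    have i1 (P : FitP F n k) : Finite ((Fin k → F) ≃ₗ[F] U P) := finite_equiv _ _
    have i2 (P : FitP F n k) : Finite ((Fin l → F) ≃ₗ[F] W P) := finite_equiv _ _
    have i3 (P : FitP F n k) : Finite (S P) := Finite.instProd
    have hc : ∀ P, Nat.card (S P) = gl F k * gl F l := by
      intro P
      simp only [S]
      rw [Nat.card_prod, card_equiv_eq (F := F) k (by simp) P.2.2,
        card_equiv_eq (F := F) l (by simp) (hW P)]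
    rw [Nat.card_sigma, Finset.sum_congr rfl (fun P _ => hc P)]
    simp
  have key2 : Nat.card ((((Fin k → F) × (Fin l → F)) ≃ₗ[F] (Fin n → F)) × NilP F k × InvP F l) =
      gl F n * (nilPairs F k * invPairs F l) := by
    rw [Nat.card_prod, Nat.card_prod, card_equiv_eq (F := F) n (by simp [hn]) (by simp)]
    rfl
  rw [← key, ← key2]
  let ee : ∀ P, S P → (((Fin k → F) × (Fin l → F)) ≃ₗ[F] (Fin n → F)) := fun P s =>
    (s.1.prodCongr s.2).trans (Submodule.prodEquivOfIsCompl _ _ (hUW P))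
  have hee : ∀ P s u w, ee P s (u, w) = (s.1 u : Fin n → F) + (s.2 w : Fin n → F) := by
    intro P s u w; simp [ee]
  let NN : ∀ P, S P → NilP F k := fun P s =>
    ⟨(cj s.1 (P.1.1.restrict (inv_ker P.1.1 P.1.2 P.2.1 (n + 1))),
      cj s.1 (P.1.2.restrict (inv_ker P.1.2 P.1.2 rfl (n + 1)))), by
      simp only
      rw [← cj_mul, ← cj_mul, restrict_comm _ _ _ _ _ P.2.1], cj_nil _ _ (restrict_nil _ _)⟩
  let II : ∀ P, S P → InvP F l := fun P s =>
    ⟨(cj s.2 (P.1.1.restrict (inv_range P.1.1 P.1.2 P.2.1 (n + 1))),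
      cj s.2 (P.1.2.restrict (inv_range P.1.2 P.1.2 rfl (n + 1)))), by
      simp only
      rw [← cj_mul, ← cj_mul, restrict_comm _ _ _ _ _ P.2.1],
      cj_unit _ _ (restrict_unit _ _ (by simp) (by omega))⟩
  have hA : ∀ P s u w, P.1.1 (ee P s (u, w)) = ee P s ((NN P s).1.1 u, (II P s).1.1 w) := by
    intro P s u w
    rw [hee, hee, map_add]
    simp [NN, II, cj_apply]
  have hB : ∀ P s u w, P.1.2 (ee P s (u, w)) = ee P s ((NN P s).1.2 u, (II P s).1.2 w) := by
    intro P s u w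
    rw [hee, hee, map_add]
    simp [NN, II, cj_apply]
  refine Nat.card_congr (Equiv.ofBijective
    (fun x => (ee x.1 x.2, NN x.1 x.2, II x.1 x.2)) ⟨?_, ?_⟩)
  · rintro ⟨P, s⟩ ⟨P', s'⟩ h
    simp only [Prod.mk.injEq] at h
    obtain ⟨h1, h2, h3⟩ := h
    have hP : P = P' := by
      apply Subtype.ext
      refine Prod.ext ?_ ?_
      · apply LinearMap.ext
        intro v
        obtain ⟨⟨u, w⟩, rfl⟩ := (ee P s).surjective v
        rw [hA, h2, h3, h1, hA]
      · apply LinearMap.ext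
        intro v
        obtain ⟨⟨u, w⟩, rfl⟩ := (ee P s).surjective v
        rw [hB, h2, h3, h1, hB]
    subst hP
    have : s = s' := by
      refine Prod.ext ?_ ?_
      · apply LinearEquiv.ext
        intro u
        apply Subtype.ext
        have h4 := hee P s u 0
        rw [h1, hee] at h4
        simpa using h4.symm
      · apply LinearEquiv.ext
        intro u
        apply Subtype.ext
        have h4 := hee P s 0 u
        rw [h1, hee] at h4
        simpa using h4.symm
    rw [this]
  · rintro ⟨e, ⟨⟨A0, N⟩, hc0, hN⟩, ⟨⟨A1, g⟩, hc1, hg⟩⟩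
    simp only at hc0 hN hc1 hg
    let A : Module.End F (Fin n → F) := cj e.symm (A0.prodMap A1)
    let B : Module.End F (Fin n → F) := cj e.symm (N.prodMap g)
    have eA : ∀ u w, A (e (u, w)) = e (A0 u, A1 w) := by intro u w; simp [A, cj_apply]
    have eB : ∀ u w, B (e (u, w)) = e (N u, g w) := by intro u w; simp [B, cj_apply]
    have eBp : ∀ m u w, (B ^ m) (e (u, w)) = e ((N ^ m) u, (g ^ m) w) := by
      intro m
      induction m with
      | zero => intro u w; simp
      | succ m ih => intro u w; rw [pow_succ, Module.End.mul_apply, eB, ih, pow_succ, pow_succ]; rfl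
    have hN0 : N ^ (n + 1) = 0 := by
      have h2 := (LinearMap.isNilpotent_iff_charpoly N).1 hN
      have h3 := LinearMap.aeval_self_charpoly N
      rw [h2] at h3
      have h4 : N ^ k = 0 := by simpa using h3
      exact pow_eq_zero_of_le (by omega) h4
    have hgb : Function.Bijective (g ^ (n + 1)) := (Module.End.isUnit_iff _).1 (hg.pow _)
    have hker : LinearMap.range (e.toLinearMap ∘ₗ LinearMap.inl F (Fin k → F) (Fin l → F)) =
        LinearMap.ker (B ^ (n + 1)) := by
      ext v
      constructor
      · rintro ⟨u, rfl⟩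
        simp [eBp, hN0]
      · intro hv
        obtain ⟨⟨u, w⟩, rfl⟩ := e.surjective v
        rw [LinearMap.mem_ker, eBp] at hv
        have := (LinearEquiv.map_eq_zero_iff e).1 hv
        rw [Prod.mk_eq_zero] at this
        have hw : w = 0 := hgb.1 (by rw [this.2, map_zero])
        subst hw
        exact ⟨u, rfl⟩
    have hran : LinearMap.range (e.toLinearMap ∘ₗ LinearMap.inr F (Fin k → F) (Fin l → F)) =
        LinearMap.range (B ^ (n + 1)) := by
      ext v
      constructor
      · rintro ⟨w, rfl⟩
        obtain ⟨w', rfl⟩ := hgb.2 w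
        refine ⟨e (0, w'), ?_⟩
        rw [eBp]; simp
      · rintro ⟨v, rfl⟩
        obtain ⟨⟨u, w⟩, rfl⟩ := e.surjective v
        rw [eBp, hN0]
        exact ⟨(g ^ (n + 1)) w, rfl⟩
    have hi0 : Function.Injective (e.toLinearMap ∘ₗ LinearMap.inl F (Fin k → F) (Fin l → F)) :=
      e.injective.comp LinearMap.inl_injective
    have hi1 : Function.Injective (e.toLinearMap ∘ₗ LinearMap.inr F (Fin k → F) (Fin l → F)) :=
      e.injective.comp LinearMap.inr_injective
    let P : FitP F n k := ⟨(A, B), by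
      apply LinearMap.ext
      intro v
      obtain ⟨⟨u, w⟩, rfl⟩ := e.surjective v
      simp only [Module.End.mul_apply, eA, eB]
      have q0 := LinearMap.congr_fun hc0 u
      have q1 := LinearMap.congr_fun hc1 w
      simp only [Module.End.mul_apply] at q0 q1
      rw [q0, q1], by
      change Module.finrank F (LinearMap.ker (B ^ (n + 1))) = k
      rw [← hker, LinearMap.finrank_range_of_inj hi0]; simp⟩
    let e0 : (Fin k → F) ≃ₗ[F] U P := (LinearEquiv.ofInjective _ hi0).trans (LinearEquiv.ofEq _ _ hker)
    let e1 : (Fin l → F) ≃ₗ[F] W P := (LinearEquiv.ofInjective _ hi1).trans (LinearEquiv.ofEq _ _ hran)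
    have he0 : ∀ u, (e0 u : Fin n → F) = e (u, 0) := fun u => rfl
    have he1 : ∀ u, (e1 u : Fin n → F) = e (0, u) := fun u => rfl
    have hes : ee P (e0, e1) = e := by
      apply LinearEquiv.ext
      rintro ⟨u, w⟩
      rw [hee]
      change (e0 u : Fin n → F) + (e1 w : Fin n → F) = _
      rw [he0, he1, ← map_add]; simp
    have fA : ∀ u w, ((NN P (e0, e1)).1.1 u, (II P (e0, e1)).1.1 w) = (A0 u, A1 w) := by
      intro u w
      apply e.injective
      have := hA P (e0, e1) u w
      rw [hes] at this
      rw [← this]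
      exact eA u w
    have fB : ∀ u w, ((NN P (e0, e1)).1.2 u, (II P (e0, e1)).1.2 w) = (N u, g w) := by
      intro u w
      apply e.injective
      have := hB P (e0, e1) u w
      rw [hes] at this
      rw [← this]
      exact eB u w
    refine ⟨⟨P, (e0, e1)⟩, ?_⟩
    refine Prod.ext hes (Prod.ext (Subtype.ext (Prod.ext ?_ ?_)) (Subtype.ext (Prod.ext ?_ ?_)))
    · apply LinearMap.ext; intro u; exact congrArg Prod.fst (fA u 0)
    · apply LinearMap.ext; intro u; exact congrArg Prod.fst (fB u 0)
    · apply LinearMap.ext; intro u; exact congrArg Prod.snd (fA 0 u)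
    · apply LinearMap.ext; intro u; exact congrArg Prod.snd (fB 0 u)

theorem allP_eq (n : ℕ) : (Nat.card (AllP F n) : ℝ≥0) / gl F n =
    ∑ p ∈ Finset.HasAntidiagonal.antidiagonal n, nu F p.1 * (invPairs F p.2 / gl F p.2) := by
  have h1 : Nat.card (AllP F n) = ∑ k ∈ Finset.range (n + 1), Nat.card (FitP F n k) := by
    let f : AllP F n → Fin (n + 1) := fun P =>
      ⟨Module.finrank F (LinearMap.ker (P.1.2 ^ (n + 1))), by
        rw [Nat.lt_succ_iff]
        simpa using Submodule.finrank_le (LinearMap.ker (P.1.2 ^ (n + 1)))⟩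
    rw [card_sum_fib f, Finset.sum_range]
    refine Finset.sum_congr rfl fun r _ => ?_
    exact Nat.card_congr
      { toFun := fun P => ⟨P.1.1, P.1.2, congrArg Fin.val P.2⟩
        invFun := fun P => ⟨⟨P.1, P.2.1⟩, Fin.ext P.2.2⟩
        left_inv := fun P => rfl
        right_inv := fun P => rfl }
  rw [h1, Nat.cast_sum, Finset.sum_div,
    ← Finset.Nat.sum_antidiagonal_eq_sum_range_succ (fun k l =>
      (Nat.card (FitP F n k) : ℝ≥0) / gl F n)]
  refine Finset.sum_congr rfl fun p hp => ?_
  rw [Finset.HasAntidiagonal.mem_antidiagonal] at hp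
  subst hp
  have h := fit_card (F := F) p.1 p.2
  have h' : (Nat.card (FitP F (p.1 + p.2) p.1) : ℝ≥0) * (gl F p.1 * gl F p.2) =
    gl F (p.1 + p.2) * (nilPairs F p.1 * invPairs F p.2) := by exact_mod_cast h
  rw [nu, div_mul_div_comm, div_eq_div_iff (gl_ne _) (mul_ne_zero (gl_ne _) (gl_ne _)), h']
  ring

end FF

namespace FF
set_option linter.unusedSectionVars false
set_option linter.unusedVariables false
open scoped ENNReal NNReal
open Polynomial
variable (F : Type) [Field F] [Fintype F]

abbrev Irr : Type := {P : F[X] // P.Monic ∧ Irreducible P}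

noncomputable instance decIrr : DecidableEq (Irr F × ℕ) := Classical.decEq _

abbrev Cyc (x : Irr F × ℕ) : Type := F[X] ⧸ Ideal.span {(x.1 : F[X]) ^ (x.2 + 1)}

abbrev Md (s : Multiset (Irr F × ℕ)) : Type := ∀ i : s, Cyc F (i : Irr F × ℕ)

noncomputable def wt (s : Multiset (Irr F × ℕ)) : ℕ :=
  (s.map (fun x => (x.1 : F[X]).natDegree * (x.2 + 1))).sum

variable {F}

theorem equiv_toType {ι α : Type} [Fintype ι] [DecidableEq α] (g : ι → α) :
    ∃ σ : ι ≃ ((Finset.univ : Finset ι).val.map g), ∀ i, ((σ i : α)) = g i := by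
  classical
  let f : ι → ((Finset.univ : Finset ι).val : Type) := fun i =>
    Multiset.mkToType _ i ⟨0, by rw [Multiset.count_pos]; simp⟩
  have hf : Function.Bijective f := by
    rw [Fintype.bijective_iff_injective_and_card]
    constructor
    · intro i j h
      exact congrArg Sigma.fst h
    · rw [Multiset.card_coe]; rfl
  refine ⟨(Equiv.ofBijective f hf).trans (Multiset.mapEquiv _ g), fun i => ?_⟩
  rw [Equiv.trans_apply, Multiset.mapEquiv_apply]
  rfl

theorem monic_pow (x : Irr F × ℕ) (k : ℕ) : ((x.1 : F[X]) ^ k).Monic := x.1.2.1.pow k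

theorem finq {f : F[X]} (hf : f.Monic) : Module.Finite F (F[X] ⧸ Ideal.span {f}) :=
  hf.finite_adjoinRoot

instance finCyc (x : Irr F × ℕ) : Module.Finite F (Cyc F x) := finq (monic_pow x _)

theorem card_quot {f : F[X]} (hf : f.Monic) :
    Nat.card (F[X] ⧸ Ideal.span {f}) = Fintype.card F ^ f.natDegree := by
  have := finq hf
  rw [Module.natCard_eq_pow_finrank (K := F), finrank_quotient_span_eq_natDegree,
    Nat.card_eq_fintype_card]

theorem finrank_Md (s : Multiset (Irr F × ℕ)) : Module.finrank F (Md F s) = wt F s := by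
  rw [Module.finrank_pi_fintype, wt, ← Multiset.map_univ]
  refine Finset.sum_congr rfl fun i _ => ?_
  rw [finrank_quotient_span_eq_natDegree, natDegree_pow, mul_comm]

/-- the torsion count -/
noncomputable def tor (f : F[X]) (M : Type) [AddCommGroup M] [Module F[X] M] : ℕ :=
  Nat.card {v : M // f • v = 0}

theorem tor_congr (f : F[X]) {M N : Type} [AddCommGroup M] [Module F[X] M] [AddCommGroup N]
    [Module F[X] N] (e : M ≃ₗ[F[X]] N) : tor f M = tor f N := by
  refine Nat.card_congr (e.toEquiv.subtypeEquiv fun v => ?_)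
  show _ ↔ f • e v = 0
  rw [← map_smul, LinearEquiv.map_eq_zero_iff]

theorem tor_pi (f : F[X]) {ι : Type} [Fintype ι] (M : ι → Type) [∀ i, AddCommGroup (M i)]
    [∀ i, Module F[X] (M i)] : tor f (∀ i, M i) = ∏ i, tor f (M i) := by
  unfold tor
  rw [← Nat.card_pi]
  refine Nat.card_congr ⟨fun v i => ⟨v.1 i, congrFun v.2 i⟩, fun v => ⟨fun i => (v i).1,
    funext fun i => (v i).2⟩, fun v => rfl, fun v => rfl⟩

theorem tor_coprime {f a : F[X]} (h : IsCoprime f a) : tor f (F[X] ⧸ Ideal.span {a}) = 1 := by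
  rw [tor, Nat.card_eq_one_iff_unique]
  refine ⟨⟨fun v w => ?_⟩, ⟨⟨0, smul_zero _⟩⟩⟩
  have key : ∀ v : F[X] ⧸ Ideal.span {a}, f • v = 0 → v = 0 := by
    intro v hv
    obtain ⟨u, w, huw⟩ := h
    have h2 : a • v = 0 := by
      obtain ⟨r, rfl⟩ := Ideal.Quotient.mk_surjective v
      rw [← Ideal.Quotient.mk_eq_mk, ← Submodule.Quotient.mk_smul, Submodule.Quotient.mk_eq_zero,
        smul_eq_mul]
      exact Ideal.mem_span_singleton.2 (Dvd.intro _ rfl)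
    rw [← one_smul F[X] v, ← huw, add_smul, mul_smul, mul_smul, hv, h2, smul_zero, smul_zero,
      add_zero]
  exact Subtype.ext ((key _ v.2).trans (key _ w.2).symm)

theorem tor_self {P : F[X]} (hP : P.Monic) (k m : ℕ) :
    tor (P ^ k) (F[X] ⧸ Ideal.span {P ^ m}) = Fintype.card F ^ (P.natDegree * min k m) := by
  rcases le_total m k with h | h
  · rw [min_eq_right h, mul_comm, ← natDegree_pow, ← card_quot (hP.pow m)]
    refine Nat.card_congr (Equiv.subtypeUnivEquiv fun v => ?_)
    obtain ⟨r, rfl⟩ := Ideal.Quotient.mk_surjective v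
    rw [← Ideal.Quotient.mk_eq_mk, ← Submodule.Quotient.mk_smul, Submodule.Quotient.mk_eq_zero,
        smul_eq_mul]
    exact Ideal.mem_span_singleton.2 ((pow_dvd_pow _ h).mul_right _)
  · rw [min_eq_left h, mul_comm, ← natDegree_pow, ← card_quot (hP.pow k)]
    let ψ : F[X] →ₗ[F[X]] (F[X] ⧸ Ideal.span {P ^ m}) :=
      (Submodule.mkQ (Ideal.span {P ^ m})) ∘ₗ LinearMap.mulLeft F[X] (P ^ (m - k))
    have hψ : ∀ r, ψ r = Submodule.Quotient.mk (P ^ (m - k) * r) := fun r => rfl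
    have hm : P ^ m = P ^ (m - k) * P ^ k := by rw [← pow_add]; congr 1; omega
    have hm' : P ^ m = P ^ k * P ^ (m - k) := by rw [← pow_add]; congr 1; omega
    have hker : LinearMap.ker ψ = Ideal.span {P ^ k} := by
      ext r
      rw [LinearMap.mem_ker, hψ, Submodule.Quotient.mk_eq_zero, Ideal.mem_span_singleton,
        Ideal.mem_span_singleton, hm, mul_dvd_mul_iff_left (hP.pow _).ne_zero]
    have hr : ∀ v, v ∈ LinearMap.range ψ ↔ P ^ k • v = 0 := by
      intro v
      constructor
      · rintro ⟨r, rfl⟩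
        rw [hψ, ← Submodule.Quotient.mk_smul, Submodule.Quotient.mk_eq_zero,
          Ideal.mem_span_singleton, smul_eq_mul, ← mul_assoc, ← hm']
        exact Dvd.intro _ rfl
      · intro hv
        obtain ⟨r, rfl⟩ := Ideal.Quotient.mk_surjective v
        rw [← Ideal.Quotient.mk_eq_mk, ← Submodule.Quotient.mk_smul,
          Submodule.Quotient.mk_eq_zero, smul_eq_mul, Ideal.mem_span_singleton, hm',
          mul_dvd_mul_iff_left (hP.pow _).ne_zero] at hv
        obtain ⟨c, rfl⟩ := hv
        exact ⟨c, rfl⟩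
    rw [← hker]
    refine Nat.card_congr ((Equiv.subtypeEquivRight fun v => (hr v).symm).trans
      ψ.quotKerEquivRange.symm.toEquiv)

open Classical in
theorem tor_Md (P : Irr F) (k : ℕ) (s : Multiset (Irr F × ℕ)) :
    tor ((P : F[X]) ^ k) (Md F s) = Fintype.card F ^ ((P : F[X]).natDegree *
      (s.map (fun x => if x.1 = P then min k (x.2 + 1) else 0)).sum) := by
  rw [tor_pi, ← Multiset.map_univ]
  change _ = Fintype.card F ^ (_ * ∑ i : s, _)
  rw [Finset.mul_sum, ← Finset.prod_pow_eq_pow_sum]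
  refine Finset.prod_congr rfl fun i _ => ?_
  split_ifs with h
  · rw [← h, tor_self]
    exact (i : Irr F × ℕ).1.2.1
  · rw [mul_zero, pow_zero]
    refine tor_coprime (IsCoprime.pow ?_)
    refine (Irreducible.coprime_iff_not_dvd P.2.2).2 fun hd => h ?_
    have := (P.2.2.dvd_irreducible_iff_associated (i : Irr F × ℕ).1.2.2).1 hd
    exact Subtype.ext (eq_of_monic_of_associated P.2.1 (i : Irr F × ℕ).1.2.1 this).symm

open Classical in
theorem count_eq (P : Irr F) (e : ℕ) (s : Multiset (Irr F × ℕ)) :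
    2 * (s.map (fun x => if x.1 = P then min (e + 1) (x.2 + 1) else 0)).sum =
    (s.map (fun x => if x.1 = P then min e (x.2 + 1) else 0)).sum +
    (s.map (fun x => if x.1 = P then min (e + 2) (x.2 + 1) else 0)).sum + s.count (P, e) := by
  induction s using Multiset.induction_on with
  | empty => simp
  | cons a s ih =>
    simp only [Multiset.map_cons, Multiset.sum_cons, Multiset.count_cons]
    have : ((P, e) = a) ↔ (a.1 = P ∧ a.2 = e) := by
      rw [eq_comm]; exact Prod.ext_iff
    simp only [this]
    by_cases h1 : a.1 = P
    · by_cases h2 : a.2 = e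
      · simp only [h1, h2, if_true, true_and]
        omega
      · simp only [h1, h2, if_true, if_false, and_false]
        omega
    · simp only [h1, if_false, false_and]
      omega

theorem Md_inj {s t : Multiset (Irr F × ℕ)} (e : Md F s ≃ₗ[F[X]] Md F t) : s = t := by
  classical
  have key : ∀ (P : Irr F) k,
    (s.map (fun x => if x.1 = P then min k (x.2 + 1) else 0)).sum =
    (t.map (fun x => if x.1 = P then min k (x.2 + 1) else 0)).sum := by
    intro P k
    have h := tor_congr ((P : F[X]) ^ k) e
    rw [tor_Md, tor_Md] at h
    have h1 := Nat.pow_right_injective (Fintype.one_lt_card (α := F)) h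
    exact Nat.eq_of_mul_eq_mul_left P.2.2.natDegree_pos h1
  ext ⟨P, e⟩
  have h1 := count_eq P e s
  have h2 := count_eq P e t
  rw [key, key, key] at h1
  convert (by omega : Multiset.count (P, e) s = Multiset.count (P, e) t)

end FF

namespace FF
set_option linter.unusedSectionVars false
set_option linter.unusedVariables false
open scoped ENNReal NNReal DirectSum
open Polynomial
variable {F : Type} [Field F] [Fintype F]

def Rl {n : ℕ} (A : Module.End F (Fin n → F)) (s : Multiset (Irr F × ℕ)) : Prop :=
  Nonempty (Module.AEval' A ≃ₗ[F[X]] Md F s)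

theorem monicize {p : F[X]} (hp : Irreducible p) : ∃ P : Irr F, Associated p (P : F[X]) := by
  classical
  refine ⟨⟨normalize p, monic_normalize hp.ne_zero, ?_⟩, (normalize_associated p).symm⟩
  exact (associated_normalize p).irreducible hp

theorem Rl_of_family {M : Type} [AddCommGroup M] [Module F[X] M] {ι : Type} [Fintype ι]
    (g : ι → Irr F × ℕ) (e : M ≃ₗ[F[X]] ∀ i, Cyc F (g i)) :
    ∃ s, Nonempty (M ≃ₗ[F[X]] Md F s) := by
  obtain ⟨σ, hσ⟩ := equiv_toType g
  let s : Multiset (Irr F × ℕ) := (Finset.univ : Finset ι).val.map g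
  let e2 : (∀ i, Cyc F (g i)) ≃ₗ[F[X]] Md F s := LinearEquiv.piCongrRight (fun i => Submodule.quotEquivOfEq _ _ (by rw [hσ i])) ≪≫ₗ
    LinearEquiv.piCongrLeft F[X] (fun j : s => Cyc F (j : Irr F × ℕ)) σ
  exact ⟨s, ⟨e.trans e2⟩⟩

theorem drop_trivial {ι : Type} [Fintype ι] (M : ι → Type) [∀ i, AddCommGroup (M i)]
    [∀ i, Module F[X] (M i)] (p : ι → Prop) (h : ∀ i, ¬ p i → Subsingleton (M i)) :
    Nonempty ((∀ i, M i) ≃ₗ[F[X]] ∀ i : {i // p i}, M i) := by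
  classical
  refine ⟨LinearEquiv.ofBijective (LinearMap.pi fun i : {i // p i} => LinearMap.proj i.1)
    ⟨?_, ?_⟩⟩
  · intro v w hvw
    funext i
    by_cases hi : p i
    · exact congrFun hvw ⟨i, hi⟩
    · have := h i hi
      exact Subsingleton.elim _ _
  · intro w
    refine ⟨fun i => if hi : p i then w ⟨i, hi⟩ else 0, ?_⟩
    funext i
    simp [i.2]

theorem exists_Rl {n : ℕ} (A : Module.End F (Fin n → F)) : ∃ s, Rl A s := by
  classical
  have htor : Module.IsTorsion F[X] (Module.AEval' A) := by
    intro x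
    refine ⟨⟨A.charpoly, mem_nonZeroDivisors_of_ne_zero A.charpoly_monic.ne_zero⟩, ?_⟩
    obtain ⟨v, rfl⟩ := (Module.AEval'.of A).surjective x
    show A.charpoly • _ = (0 : Module.AEval' A)
    rw [Module.AEval'.of, ← Module.AEval.of_aeval_smul, LinearMap.aeval_self_charpoly, zero_smul, map_zero]
  obtain ⟨ι, _, p, hp, e, ⟨E⟩⟩ := Module.equiv_directSum_of_isTorsion htor
  choose P hP using fun i => monicize (hp i)
  have E1 : Module.AEval' A ≃ₗ[F[X]] ∀ i, F[X] ⧸ Ideal.span {p i ^ e i} :=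
    E ≪≫ₗ DirectSum.linearEquivFunOnFintype F[X] ι _
  obtain ⟨E2⟩ := drop_trivial (F := F) (fun i => F[X] ⧸ Ideal.span {p i ^ e i}) (fun i => e i ≠ 0) (by
    intro i hi
    have : e i = 0 := by simpa using hi
    rw [Ideal.Quotient.subsingleton_iff, this, pow_zero, Ideal.span_singleton_one])
  refine Rl_of_family (fun i : {i // e i ≠ 0} => (P i, e i - 1)) (E1 ≪≫ₗ E2 ≪≫ₗ ?_)
  refine LinearEquiv.piCongrRight fun i => Submodule.quotEquivOfEq _ _ ?_
  rw [Ideal.span_singleton_eq_span_singleton]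
  have : e i - 1 + 1 = e i := by have := i.2; omega
  simp only [this]
  exact (hP i).pow_pow

theorem Rl_wt {n : ℕ} {A : Module.End F (Fin n → F)} {s} (h : Rl A s) : wt F s = n := by
  obtain ⟨e⟩ := h
  rw [← finrank_Md, ← (e.restrictScalars F).finrank_eq, ← (Module.AEval'.of A).finrank_eq]
  simp

theorem exists_of_wt {n : ℕ} {s} (h : wt F s = n) : ∃ A : Module.End F (Fin n → F), Rl A s := by
  have h1 : Module.finrank F (Fin n → F) = Module.finrank F (Md F s) := by
    rw [finrank_Md, h]; simp
  let e : (Fin n → F) ≃ₗ[F] Md F s := LinearEquiv.ofFinrankEq _ _ h1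
  let A : Module.End F (Fin n → F) :=
    e.symm.toLinearMap ∘ₗ ((LinearMap.lsmul F[X] (Md F s) X).restrictScalars F) ∘ₗ e.toLinearMap
  refine ⟨A, ⟨LinearEquiv.ofAEval A e fun m => ?_⟩⟩
  show e (e.symm ((X : F[X]) • e m)) = _
  rw [LinearEquiv.apply_symm_apply]

theorem conj_of_equiv {n : ℕ} {A B : Module.End F (Fin n → F)}
    (e : Module.AEval' A ≃ₗ[F[X]] Module.AEval' B) :
    ∃ u : (Module.End F (Fin n → F))ˣ, u * A * (u⁻¹ : (Module.End F (Fin n → F))ˣ) = B := by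
  let f : (Fin n → F) ≃ₗ[F] (Fin n → F) :=
    (Module.AEval'.of A) ≪≫ₗ e.restrictScalars F ≪≫ₗ (Module.AEval'.of B).symm
  have hf : ∀ v, f (A v) = B (f v) := by
    intro v
    show (Module.AEval'.of B).symm (e (Module.AEval'.of A (A v))) = _
    rw [← Module.AEval'.X_smul_of, map_smul, Module.AEval'.of_symm_X_smul]
    rfl
  refine ⟨LinearMap.GeneralLinearGroup.ofLinearEquiv f, ?_⟩
  rw [Units.mul_inv_eq_iff_eq_mul]
  exact LinearMap.ext fun v => hf v

theorem equiv_of_conj {n : ℕ} {A B : Module.End F (Fin n → F)}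
    (u : (Module.End F (Fin n → F))ˣ) (h : u * A * (u⁻¹ : (Module.End F (Fin n → F))ˣ) = B) :
    Nonempty (Module.AEval' A ≃ₗ[F[X]] Module.AEval' B) := by
  rw [Units.mul_inv_eq_iff_eq_mul] at h
  let f : (Fin n → F) ≃ₗ[F] (Fin n → F) := LinearMap.GeneralLinearGroup.toLinearEquiv u
  refine ⟨LinearEquiv.ofAEval A (f ≪≫ₗ Module.AEval'.of B) fun m => ?_⟩
  rw [LinearEquiv.trans_apply, LinearEquiv.trans_apply, Module.AEval'.X_smul_of]
  congr 1
  exact LinearMap.congr_fun h m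


theorem card_orbits (n : ℕ) : Nat.card (Quotient (MulAction.orbitRel
      (ConjAct (Module.End F (Fin n → F))ˣ) (Module.End F (Fin n → F)))) =
    Nat.card {s : Multiset (Irr F × ℕ) // wt F s = n} := by
  choose inv hinv using fun A : Module.End F (Fin n → F) => exists_Rl A
  have h1 : ∀ A B, (MulAction.orbitRel (ConjAct (Module.End F (Fin n → F))ˣ)
      (Module.End F (Fin n → F))) A B ↔ inv A = inv B := by
    intro A B
    rw [MulAction.orbitRel_apply, MulAction.mem_orbit_iff]
    constructor
    · rintro ⟨u, hu⟩
      rw [ConjAct.units_smul_def] at hu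
      obtain ⟨e⟩ := equiv_of_conj _ hu
      obtain ⟨eA⟩ := hinv A
      obtain ⟨eB⟩ := hinv B
      exact (Md_inj (eB.symm ≪≫ₗ e ≪≫ₗ eA)).symm
    · intro h
      obtain ⟨eA⟩ := hinv A
      obtain ⟨eB⟩ := hinv B
      rw [h] at eA
      obtain ⟨u, hu⟩ := conj_of_equiv (eB ≪≫ₗ eA.symm)
      exact ⟨ConjAct.toConjAct u, by rw [ConjAct.units_smul_def]; exact hu⟩
  let f : Quotient (MulAction.orbitRel
      (ConjAct (Module.End F (Fin n → F))ˣ) (Module.End F (Fin n → F))) →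
      {s : Multiset (Irr F × ℕ) // wt F s = n} :=
    Quotient.lift (fun A => ⟨inv A, Rl_wt (hinv A)⟩) fun A B h => Subtype.ext ((h1 A B).1 h)
  refine Nat.card_congr (Equiv.ofBijective f ⟨?_, ?_⟩)
  · intro a b
    induction a using Quotient.inductionOn
    induction b using Quotient.inductionOn
    intro h
    exact Quotient.sound ((h1 _ _).2 (congrArg Subtype.val h))
  · rintro ⟨s, hs⟩
    obtain ⟨A, ⟨e⟩⟩ := exists_of_wt hs
    refine ⟨Quotient.mk _ A, Subtype.ext ?_⟩
    obtain ⟨eA⟩ := hinv A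
    exact Md_inj (eA.symm ≪≫ₗ e)

theorem invPairs_eq (n : ℕ) : invPairs F n =
    Nat.card {s : Multiset (Irr F × ℕ) // wt F s = n} * gl F n := by
  classical
  have : Finite (Module.End F (Fin n → F)) := inferInstance
  let G := ConjAct (Module.End F (Fin n → F))ˣ
  have : Finite G := inferInstanceAs (Finite (Module.End F (Fin n → F))ˣ)
  have hG : Nat.card G = gl F n :=
    Nat.card_congr (LinearMap.GeneralLinearGroup.generalLinearEquiv F (Fin n → F)).toEquiv
  rw [← card_orbits, ← hG, ← Nat.card_prod,
    ← Nat.card_congr (MulAction.sigmaFixedByEquivOrbitsProdGroup G (Module.End F (Fin n → F)))]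
  symm
  refine Nat.card_congr (Equiv.ofBijective (fun p => ⟨(p.2.1, (ConjAct.ofConjAct p.1 :
    (Module.End F (Fin n → F))ˣ)), ?_, Units.isUnit _⟩) ⟨?_, ?_⟩)
  · have := p.2.2
    rw [MulAction.mem_fixedBy, ConjAct.units_smul_def, Units.mul_inv_eq_iff_eq_mul] at this
    exact this.symm
  · rintro ⟨g, A, hA⟩ ⟨g', A', hA'⟩ h
    have h1 := congrArg Subtype.val h
    have h2 : A = A' := congrArg Prod.fst h1
    have h3 : g = g' := Units.ext (congrArg Prod.snd h1)
    subst h2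
    subst h3
    rfl
  · rintro ⟨⟨A, B⟩, h1, h2⟩
    have h3 := h2
    obtain ⟨u, hu⟩ := h3
    refine ⟨⟨ConjAct.toConjAct u, A, ?_⟩, Subtype.ext (Prod.ext rfl hu)⟩
    rw [MulAction.mem_fixedBy, ConjAct.units_smul_def, Units.mul_inv_eq_iff_eq_mul]
    show (u : Module.End F (Fin n → F)) * A = A * u
    rw [hu]
    exact h1.symm

end FF

namespace FF
set_option linter.unusedSectionVars false
set_option linter.unusedVariables false
open scoped ENNReal NNReal
open Polynomial
variable {F : Type} [Field F] [Fintype F]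

theorem tendsto_trunc {α : Type} (h : α → ℕ) (f : α → ℝ≥0∞) :
    Filter.Tendsto (fun n => ∑' a, if h a ≤ n then f a else 0) Filter.atTop (nhds (∑' a, f a)) := by
  classical
  have h1 : ∑' a, f a = ∑' k : ℕ, ∑' a, if h a = k then f a else 0 := by
    rw [ENNReal.tsum_comm]
    refine tsum_congr fun a => ?_
    rw [tsum_eq_single (h a)]
    · simp
    · intro k hk; rw [if_neg hk.symm]
  rw [h1]
  have h2 := (ENNReal.tendsto_nat_tsum (fun k : ℕ => ∑' a, if h a = k then f a else 0)).comp
    (Filter.tendsto_add_atTop_nat 1)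
  refine h2.congr fun n => ?_
  show ∑ k ∈ Finset.range (n + 1), _ = _
  rw [← Summable.tsum_finsetSum (fun _ _ => ENNReal.summable)]
  refine tsum_congr fun a => ?_
  rw [Finset.sum_ite_eq]
  simp

noncomputable def dg (u : Multiset (Irr F)) : ℕ := (u.map fun P : Irr F => (P : F[X]).natDegree).sum

noncomputable def Wc (c : ℕ) (s : Multiset (Irr F × ℕ)) : ℕ :=
  (s.map (fun x => (x.1 : F[X]).natDegree * (x.2 + c))).sum

def spl (p : Multiset (Irr F) × Multiset (Irr F × ℕ)) : Multiset (Irr F × ℕ) :=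
  p.1.map (fun P => (P, 0)) + p.2.map (fun x => (x.1, x.2 + 1))

theorem spl_bij : Function.Bijective (spl (F := F)) := by
  classical
  have f1 : ∀ p : Multiset (Irr F) × Multiset (Irr F × ℕ),
      (spl p).filter (fun x => x.2 = 0) = p.1.map (fun P => (P, 0)) := by
    intro p
    rw [spl, Multiset.filter_add, Multiset.filter_eq_self.2, Multiset.filter_eq_nil.2, add_zero]
    · intro a ha
      obtain ⟨b, _, rfl⟩ := Multiset.mem_map.1 ha
      simp
    · intro a ha
      obtain ⟨b, _, rfl⟩ := Multiset.mem_map.1 ha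
      simp
  constructor
  · intro p p' h
    have h1 : p.1.map (fun P => (P, 0)) = p'.1.map (fun P => ((P, 0) : Irr F × ℕ)) := by
      rw [← f1 p, ← f1 p', h]
    have h2 : p.2.map (fun x => (x.1, x.2 + 1)) =
        p'.2.map (fun x => ((x.1, x.2 + 1) : Irr F × ℕ)) := by
      rw [spl, spl, h1] at h
      exact add_left_cancel h
    refine Prod.ext ?_ ?_
    · exact Multiset.map_injective (fun a b hab => congrArg Prod.fst hab) h1
    · refine Multiset.map_injective (fun a b hab => ?_) h2
      have e1 := congrArg Prod.fst hab
      have e2 := congrArg Prod.snd hab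
      exact Prod.ext e1 (Nat.succ_injective e2)
  · intro s
    refine ⟨((s.filter (fun x => x.2 = 0)).map Prod.fst,
      (s.filter (fun x => ¬ x.2 = 0)).map (fun x => (x.1, x.2 - 1))), ?_⟩
    rw [spl, Multiset.map_map, Multiset.map_map]
    conv_rhs => rw [← Multiset.filter_add_not (fun x => x.2 = 0) s]
    congr 1
    · conv_rhs => rw [← Multiset.map_id (Multiset.filter _ s)]
      refine Multiset.map_congr rfl fun x hx => ?_
      have := (Multiset.mem_filter.1 hx).2
      exact Prod.ext rfl this.symm
    · conv_rhs => rw [← Multiset.map_id (Multiset.filter _ s)]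
      refine Multiset.map_congr rfl fun x hx => ?_
      have := (Multiset.mem_filter.1 hx).2
      refine Prod.ext rfl ?_
      show x.2 - 1 + 1 = x.2
      omega

theorem Wc_spl (c : ℕ) (p : Multiset (Irr F) × Multiset (Irr F × ℕ)) :
    Wc c (spl p) = dg p.1 * c + Wc (c + 1) p.2 := by
  rw [Wc, spl, Multiset.map_add, Multiset.sum_add, Multiset.map_map, Multiset.map_map, Wc, dg,
    ← Multiset.sum_map_mul_right]
  congr 2
  · simp
  · refine Multiset.map_congr rfl fun x _ => ?_
    show _ * (x.2 + 1 + c) = _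
    ring

theorem prodIrr_bij : Function.Bijective
    (fun u : Multiset (Irr F) => (⟨(u.map Subtype.val).prod,
      monic_multiset_prod_of_monic _ _ (fun P _ => P.2.1)⟩ : {f : F[X] // f.Monic})) := by
  classical
  constructor
  · intro u v h
    have h1 : (u.map Subtype.val).prod = (v.map Subtype.val).prod := congrArg Subtype.val h
    have h2 := UniqueFactorizationMonoid.factors_unique (f := u.map Subtype.val)
      (g := v.map Subtype.val) (by
        intro x hx; obtain ⟨P, _, rfl⟩ := Multiset.mem_map.1 hx; exact P.2.2) (by
        intro x hx; obtain ⟨P, _, rfl⟩ := Multiset.mem_map.1 hx; exact P.2.2)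
        (by rw [h1]; exact Associated.refl _)
    rw [Multiset.rel_map] at h2
    rw [← Multiset.rel_eq]
    refine h2.mono fun a _ b _ hab => ?_
    exact Subtype.ext (eq_of_monic_of_associated a.2.1 b.2.1 hab)
  · rintro ⟨f, hf⟩
    have h1 : ∀ x ∈ UniqueFactorizationMonoid.normalizedFactors f, x.Monic ∧ Irreducible x := by
      intro x hx
      refine ⟨?_, UniqueFactorizationMonoid.irreducible_of_normalized_factor x hx⟩
      rw [← UniqueFactorizationMonoid.normalize_normalized_factor x hx]
      exact monic_normalize (UniqueFactorizationMonoid.irreducible_of_normalized_factor x hx).ne_zero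
    refine ⟨(UniqueFactorizationMonoid.normalizedFactors f).pmap (fun x hx => ⟨x, hx⟩) h1, ?_⟩
    refine Subtype.ext ?_
    show (Multiset.map _ _).prod = f
    rw [Multiset.map_pmap]
    simp only [Multiset.pmap_eq_map, Multiset.map_id']
    rw [UniqueFactorizationMonoid.prod_normalizedFactors_eq hf.ne_zero]
    exact hf.normalize_eq_self

theorem dg_eq (u : Multiset (Irr F)) : (u.map Subtype.val).prod.natDegree = dg u := by
  rw [natDegree_multiset_prod_of_monic, Multiset.map_map, dg]
  · rfl
  · intro f hf
    obtain ⟨P, _, rfl⟩ := Multiset.mem_map.1 hf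
    exact P.2.1

theorem card_monic (d : ℕ) : Nat.card {f : F[X] // f.Monic ∧ f.natDegree = d} =
    Fintype.card F ^ d := by
  have e1 : {f : F[X] // f.Monic ∧ f.natDegree = d} ≃ degreeLT F d := 
    { toFun := fun f => ⟨f.1 - X ^ d, by
        rw [mem_degreeLT]
        have h : f.1.degree = d := by rw [degree_eq_natDegree f.2.1.ne_zero, f.2.2]
        rw [← h]
        apply degree_sub_lt_left
        · rw [h, degree_X_pow]
        · exact f.2.1.ne_zero
        · rw [f.2.1.leadingCoeff, leadingCoeff_X_pow]⟩
      invFun := fun g => ⟨X ^ d + g.1, monic_X_pow_add (mem_degreeLT.1 g.2), by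
        rw [natDegree_add_eq_left_of_degree_lt]
        · simp
        · rw [degree_X_pow]; exact mem_degreeLT.1 g.2⟩
      left_inv := fun f => by simp
      right_inv := fun g => by simp }
  rw [Nat.card_congr e1, Nat.card_congr (degreeLTEquiv F d).toEquiv]
  simp

theorem card_dg (d : ℕ) : Nat.card {u : Multiset (Irr F) // dg u = d} = Fintype.card F ^ d := by
  rw [← card_monic]
  refine Nat.card_congr (((Equiv.ofBijective _ prodIrr_bij).subtypeEquiv
    (q := fun f : {f : F[X] // f.Monic} => f.1.natDegree = d) fun u => ?_).trans
      (Equiv.subtypeSubtypeEquivSubtypeInter Monic (fun f : F[X] => f.natDegree = d)))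
  show _ ↔ (u.map Subtype.val).prod.natDegree = d
  rw [dg_eq]

theorem tsum_ite_card {α : Type} (p : α → Prop) [DecidablePred p] (c : ℝ≥0∞) [Finite {a // p a}] :
    ∑' a, (if p a then c else 0) = Nat.card {a // p a} * c := by
  have := Fintype.ofFinite {a // p a}
  rw [← tsum_subtype_eq_of_support_subset (s := {a | p a})]
  · rw [tsum_congr (g := fun _ => c) (fun a => if_pos a.2)]
    change ∑' _ : {a // p a}, c = _
    rw [tsum_fintype]
    simp
  · intro a ha
    by_contra h
    exact ha (if_neg h)

theorem fin_dg (d : ℕ) : Finite {u : Multiset (Irr F) // dg u = d} :=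
  Nat.finite_of_card_ne_zero (by rw [card_dg]; exact pow_ne_zero _ Fintype.card_ne_zero)

theorem tsum_dg (y : ℝ≥0∞) : ∑' u : Multiset (Irr F), y ^ dg u =
    (1 - (Fintype.card F : ℝ≥0∞) * y)⁻¹ := by
  classical
  rw [← ENNReal.tsum_geometric]
  have : ∀ u : Multiset (Irr F), y ^ dg u = ∑' d : ℕ, if dg u = d then y ^ d else 0 := by
    intro u
    rw [tsum_eq_single (dg u)]
    · simp
    · intro d hd; rw [if_neg hd.symm]
  simp_rw [this]
  rw [ENNReal.tsum_comm]
  refine tsum_congr fun d => ?_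
  have := fin_dg (F := F) d
  rw [tsum_ite_card, card_dg, mul_pow]
  push_cast
  rfl

theorem q_mul_xx (j : ℕ) : (Fintype.card F : ℝ≥0∞) * (xx F : ℝ≥0∞) ^ (j + 1) = (xx F : ℝ≥0∞) ^ j := by
  have : (Fintype.card F : ℝ≥0) * (xx F) ^ (j + 1) = (xx F) ^ j := by
    rw [pow_succ', ← mul_assoc, xx, mul_inv_cancel₀, one_mul]
    exact Nat.cast_ne_zero.2 Fintype.card_ne_zero
  exact_mod_cast congrArg (fun z : ℝ≥0 => (z : ℝ≥0∞)) this

open Classical in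
noncomputable def SK (F : Type) [Field F] [Fintype F] (c K : ℕ) : ℝ≥0∞ :=
  ∑' s : Multiset (Irr F × ℕ), if (∀ x ∈ s, x.2 < K) then (xx F : ℝ≥0∞) ^ Wc c s else 0

theorem SK_zero (c : ℕ) : SK F c 0 = 1 := by
  rw [SK, tsum_eq_single 0]
  · simp [Wc]
  · intro s hs
    rw [if_neg]
    intro h
    obtain ⟨a, ha⟩ := Multiset.exists_mem_of_ne_zero hs
    exact absurd (h a ha) (by simp)

theorem mem_spl (K : ℕ) (p : Multiset (Irr F) × Multiset (Irr F × ℕ)) :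
    (∀ x ∈ spl p, x.2 < K + 1) ↔ ∀ x ∈ p.2, x.2 < K := by
  constructor
  · intro h x hx
    have := h (x.1, x.2 + 1) (by
      rw [spl, Multiset.mem_add]; right; exact Multiset.mem_map.2 ⟨x, hx, rfl⟩)
    simpa using this
  · intro h x hx
    rw [spl, Multiset.mem_add] at hx
    rcases hx with hx | hx
    · obtain ⟨b, _, rfl⟩ := Multiset.mem_map.1 hx
      simp
    · obtain ⟨b, hb, rfl⟩ := Multiset.mem_map.1 hx
      simpa using h b hb

theorem SK_succ (j K : ℕ) : SK F (j + 1) (K + 1) =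
    (1 - (xx F : ℝ≥0∞) ^ j)⁻¹ * SK F (j + 2) K := by
  classical
  rw [SK, ← (Equiv.ofBijective _ (spl_bij (F := F))).tsum_eq, ENNReal.tsum_prod', ← q_mul_xx,
    ← tsum_dg, ← ENNReal.tsum_mul_right]
  refine tsum_congr fun u => ?_
  rw [SK, ← ENNReal.tsum_mul_left]
  refine tsum_congr fun v => ?_
  rw [Equiv.ofBijective_apply, Wc_spl, mul_ite, mul_zero, ← pow_mul, ← pow_add]
  refine if_congr (mem_spl K (u, v)) ?_ rfl
  rw [mul_comm (dg u)]

theorem SK_eq (K : ℕ) : ∀ j, SK F (j + 2) K =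
    ∏ i ∈ Finset.range K, (1 - (xx F : ℝ≥0∞) ^ (j + 1 + i))⁻¹ := by
  induction K with
  | zero => intro j; simp [SK_zero]
  | succ K ih =>
    intro j
    rw [SK_succ, ih, Finset.prod_range_succ', mul_comm]
    congr 1
    refine Finset.prod_congr rfl fun i _ => ?_
    congr 3
    ring

noncomputable def SS (F : Type) [Field F] [Fintype F] : ℝ≥0∞ :=
  ∑' s : Multiset (Irr F × ℕ), (xx F : ℝ≥0∞) ^ Wc 2 s

theorem tendsto_SS : Filter.Tendsto
    (fun K => ∏ i ∈ Finset.range K, (1 - (xx F : ℝ≥0∞) ^ (i + 1))⁻¹)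
    Filter.atTop (nhds (SS F)) := by
  classical
  refine (tendsto_trunc (fun s : Multiset (Irr F × ℕ) => (s.map (fun x => x.2 + 1)).sup) _).congr
    fun K => ?_
  have h := SK_eq (F := F) K 0
  rw [SK] at h
  simp only [zero_add] at h
  simp_rw [add_comm _ 1]
  rw [← h]
  refine tsum_congr fun s => if_congr ?_ rfl rfl
  rw [Multiset.sup_le]
  constructor
  · intro h x hx
    have := h _ (Multiset.mem_map_of_mem _ hx)
    omega
  · intro h b hb
    obtain ⟨x, hx, rfl⟩ := Multiset.mem_map.1 hb
    have := h x hx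
    omega

noncomputable def cc (F : Type) [Field F] [Fintype F] (n : ℕ) : ℕ :=
  Nat.card {s : Multiset (Irr F × ℕ) // wt F s = n}

theorem fin_wt (n : ℕ) : Finite {s : Multiset (Irr F × ℕ) // wt F s = n} := by
  refine Nat.finite_of_card_ne_zero ?_
  rw [← card_orbits]
  have : Finite (Module.End F (Fin n → F)) := inferInstance
  exact Nat.card_pos.ne'

theorem cc_eq (n : ℕ) : (cc F n : ℝ≥0∞) * (xx F : ℝ≥0∞) ^ n =
    ∑' s : Multiset (Irr F × ℕ), if Wc 2 s ≤ n then (xx F : ℝ≥0∞) ^ Wc 2 s else 0 := by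
  classical
  have hfin := fin_wt (F := F) n
  rw [cc, ← tsum_ite_card, ← (Equiv.ofBijective _ (spl_bij (F := F))).tsum_eq, ENNReal.tsum_prod',
    ENNReal.tsum_comm]
  refine tsum_congr fun v => ?_
  have h1 : ∀ u : Multiset (Irr F), wt F (spl (u, v)) = dg u + Wc 2 v := by
    intro u
    have := Wc_spl 1 (u, v)
    rw [mul_one] at this
    exact this
  simp only [Equiv.ofBijective_apply, h1]
  split_ifs with h
  · have h2 : ∀ u : Multiset (Irr F), dg u + Wc 2 v = n ↔ dg u = n - Wc 2 v := by
      intro u; omega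
    simp only [h2]
    have := fin_dg (F := F) (n - Wc 2 v)
    rw [tsum_ite_card, card_dg]
    obtain ⟨m, rfl⟩ := Nat.exists_eq_add_of_le h
    rw [Nat.add_sub_cancel_left]
    clear h h2 this h1 hfin
    generalize Wc 2 v = w at *
    induction m with
    | zero => simp
    | succ m ih =>
      rw [← ih, ← q_mul_xx (w + m), pow_succ]
      push_cast
      ring
  · rw [ENNReal.tsum_eq_zero]
    intro u
    rw [if_neg]
    omega

theorem tendsto_cc : Filter.Tendsto (fun n => (cc F n : ℝ≥0∞) * (xx F : ℝ≥0∞) ^ n)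
    Filter.atTop (nhds (SS F)) := by
  simp_rw [cc_eq]
  exact tendsto_trunc _ _

end FF

namespace FF
set_option linter.unusedSectionVars false
set_option linter.unusedVariables false
open scoped ENNReal NNReal
open Filter
variable (F : Type) [Field F] [Fintype F]

noncomputable def xr : ℝ := (xx F : ℝ)
noncomputable def aa (l : ℕ) : ℝ := (1 - xr F ^ (l + 1))⁻¹
noncomputable def la (l : ℕ) : ℝ := Real.log (aa F l)

variable {F}

theorem xr_eq : xr F = (Fintype.card F : ℝ)⁻¹ := by simp [xr, xx]

theorem xr_pos : 0 < xr F := by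
  rw [xr_eq]; have := Fintype.card_pos (α := F); positivity

theorem xr_le : xr F ≤ 1 / 2 := by
  rw [xr_eq, one_div]
  have : (2 : ℝ) ≤ Fintype.card F := by exact_mod_cast Fintype.one_lt_card (α := F)
  exact inv_anti₀ (by norm_num) this

theorem xr_pow_le (l : ℕ) : xr F ^ (l + 1) ≤ 1 / 2 := by
  rw [pow_succ]
  have h1 : xr F ^ l ≤ 1 := pow_le_one₀ xr_pos.le (xr_le.trans (by norm_num))
  have := xr_le (F := F)
  have := xr_pos (F := F)
  nlinarith

theorem aa_ge (l : ℕ) : 1 ≤ aa F l := by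
  rw [aa]
  have := xr_pow_le (F := F) l
  have h2 : 0 < xr F ^ (l + 1) := pow_pos xr_pos _
  exact (one_le_inv₀ (by linarith)).2 (by linarith)

theorem la_nonneg (l : ℕ) : 0 ≤ la F l := Real.log_nonneg (aa_ge l)

theorem la_le (l : ℕ) : la F l ≤ 2 * xr F ^ (l + 1) := by
  have h0 := aa_ge (F := F) l
  have h1 : la F l ≤ aa F l - 1 := Real.log_le_sub_one_of_pos (by linarith)
  have := xr_pow_le (F := F) l
  have h2 : 0 < xr F ^ (l + 1) := pow_pos xr_pos _
  have h3 : aa F l - 1 ≤ 2 * xr F ^ (l + 1) := by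
    rw [aa, sub_le_iff_le_add, inv_le_iff_one_le_mul₀ (by linarith)]
    nlinarith
  linarith

theorem summable_nla : Summable (fun l : ℕ => ((l : ℝ) + 1) * la F l) := by
  have h1 : Summable (fun l : ℕ => ((l : ℝ)) ^ 1 * xr F ^ l) :=
    summable_pow_mul_geometric_of_norm_lt_one 1 (by
      rw [Real.norm_of_nonneg xr_pos.le]; have := xr_le (F := F); linarith)
  have h2 := ((summable_nat_add_iff 1).2 h1).mul_left 2
  refine Summable.of_nonneg_of_le (fun l => mul_nonneg (by positivity) (la_nonneg l))
    (fun l => ?_) h2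
  have := la_le (F := F) l
  have h3 : (0 : ℝ) ≤ (l : ℝ) + 1 := by positivity
  push_cast
  nlinarith

theorem summable_la : Summable (la F) := by
  refine Summable.of_nonneg_of_le la_nonneg (fun l => ?_) (summable_nla (F := F))
  have := la_nonneg (F := F) l
  have h3 : (0 : ℝ) ≤ (l : ℝ) := by positivity
  nlinarith

theorem exp_la (l : ℕ) : Real.exp (la F l) = aa F l :=
  Real.exp_log (by have := aa_ge (F := F) l; linarith)

theorem prod_aa (g : ℕ → ℕ) (K : ℕ) : ∏ l ∈ Finset.range K, aa F (g l) =
    Real.exp (∑ l ∈ Finset.range K, la F (g l)) := by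
  rw [Real.exp_sum]
  exact Finset.prod_congr rfl fun l _ => (exp_la _).symm

theorem gl_real (m : ℕ) : (gl F m : ℝ) = ∏ i ∈ Finset.range m,
    ((Fintype.card F : ℝ) ^ m - (Fintype.card F : ℝ) ^ i) := by
  rw [gl_eq, injF, Fin.prod_univ_eq_prod_range (fun i => Fintype.card F ^ m -
    Fintype.card F ^ i) m, Nat.cast_prod]
  refine Finset.prod_congr rfl fun i hi => ?_
  rw [Nat.cast_sub (Nat.pow_le_pow_right Fintype.card_pos (Finset.mem_range.1 hi).le)]
  push_cast
  rfl

theorem invphi_eq (m : ℕ) : (invphi F m : ℝ) = ∏ j ∈ Finset.range m, aa F j := by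
  have h0 : (invphi F m : ℝ) = (Fintype.card F : ℝ) ^ (m * m) / (gl F m : ℝ) := by
    rw [invphi]; push_cast; rfl
  have h1 : (Fintype.card F : ℝ) ^ (m * m) = ∏ i ∈ Finset.range m, (Fintype.card F : ℝ) ^ m := by
    rw [Finset.prod_const, Finset.card_range, pow_mul]
  rw [h0, gl_real, ← Finset.prod_range_reflect (aa F) m, h1, ← Finset.prod_div_distrib]
  refine Finset.prod_congr rfl fun i hi => ?_
  obtain ⟨k, rfl⟩ := Nat.exists_eq_add_of_lt (Finset.mem_range.1 hi)
  have hk : i + k + 1 - 1 - i = k := by omega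
  have hq : (1 : ℝ) < Fintype.card F := by exact_mod_cast Fintype.one_lt_card
  have hq1 : (1 : ℝ) < (Fintype.card F : ℝ) ^ (k + 1) := one_lt_pow₀ hq (by omega)
  have hq2 : (0 : ℝ) < (Fintype.card F : ℝ) ^ i := pow_pos (by linarith) _
  rw [hk, aa, xr_eq, inv_pow, add_assoc, pow_add]
  generalize (Fintype.card F : ℝ) ^ (k + 1) = y at *
  generalize (Fintype.card F : ℝ) ^ i = z at *
  have e1 : y - 1 ≠ 0 := by linarith
  have e2 : 1 - y⁻¹ = (y - 1) / y := by field_simp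
  have e3 : z * y - z = z * (y - 1) := by ring
  rw [e2, e3, inv_div, mul_div_mul_left _ _ hq2.ne']

noncomputable def II (F : Type) [Field F] [Fintype F] : ℝ := Real.exp (∑' l, la F l)

theorem invphi_le (m : ℕ) : (invphi F m : ℝ) ≤ II F := by
  rw [invphi_eq, prod_aa (fun l => l), II, Real.exp_le_exp]
  exact summable_la.sum_le_tsum _ fun l _ => la_nonneg l

theorem tendsto_invphi : Tendsto (fun m => (invphi F m : ℝ)) atTop (nhds (II F)) := by
  simp_rw [invphi_eq, prod_aa (fun l => l)]
  exact (Real.continuous_exp.tendsto _).comp summable_la.hasSum.tendsto_sum_nat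

noncomputable def ff (F : Type) [Field F] [Fintype F] (i : ℕ) : ℝ :=
  ∑' m : ℕ, (invphi F m : ℝ) * (xr F ^ (i + 1)) ^ m

theorem ff_bound (i m : ℕ) : (invphi F m : ℝ) * (xr F ^ (i + 1)) ^ m ≤ II F * xr F ^ m := by
  have h1 : xr F ^ (i + 1) ≤ xr F := by
    rw [pow_succ]
    have : xr F ^ i ≤ 1 := pow_le_one₀ xr_pos.le (xr_le.trans (by norm_num))
    have := xr_pos (F := F)
    nlinarith
  have h2 : 0 < xr F ^ (i + 1) := pow_pos xr_pos _
  gcongr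
  · exact (Real.exp_pos _).le
  · exact invphi_le m

theorem summable_bd : Summable (fun m => II F * xr F ^ m) :=
  (summable_geometric_of_lt_one xr_pos.le (by have := xr_le (F := F); linarith)).mul_left _

theorem ff_nn (i m : ℕ) : 0 ≤ (invphi F m : ℝ) * (xr F ^ (i + 1)) ^ m :=
  mul_nonneg (NNReal.coe_nonneg _) (pow_nonneg (pow_pos xr_pos _).le _)

theorem summable_ff (i : ℕ) : Summable (fun m : ℕ => (invphi F m : ℝ) * (xr F ^ (i + 1)) ^ m) :=
  Summable.of_nonneg_of_le (ff_nn i) (ff_bound i) summable_bd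

theorem Fz_eq (i : ℕ) : Fz F ((xx F : ℝ≥0∞) ^ (i + 1)) = ENNReal.ofReal (ff F i) := by
  rw [Fz, ff, ENNReal.ofReal_tsum_of_nonneg (ff_nn i) (summable_ff i)]
  refine tsum_congr fun m => ?_
  rw [ENNReal.ofReal_mul (NNReal.coe_nonneg _), ENNReal.ofReal_pow (pow_pos xr_pos _).le,
    ENNReal.ofReal_pow xr_pos.le, xr, ENNReal.ofReal_coe_nnreal, ENNReal.ofReal_coe_nnreal]

theorem tendsto_ff : Tendsto (ff F) atTop (nhds 1) := by
  have h : ∑' m : ℕ, (if m = 0 then (1 : ℝ) else 0) = 1 := by rw [tsum_ite_eq]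
  rw [← h]
  refine tendsto_tsum_of_dominated_convergence (bound := fun m => II F * xr F ^ m) summable_bd ?_ ?_
  · intro m
    by_cases hm : m = 0
    · subst hm
      simp [invphi_eq]
    · rw [if_neg hm]
      have h1 : Tendsto (fun i : ℕ => (xr F ^ (i + 1)) ^ m) atTop (nhds 0) := by
        have h2 : Tendsto (fun i : ℕ => (xr F ^ m) ^ (i + 1)) atTop (nhds 0) :=
          (tendsto_pow_atTop_nhds_zero_of_lt_one (pow_pos xr_pos _).le
            (pow_lt_one₀ xr_pos.le (by have := xr_le (F := F); linarith) hm)).comp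
            (tendsto_add_atTop_nat 1)
        refine h2.congr fun i => ?_
        rw [← pow_mul, ← pow_mul, mul_comm]
      simpa using h1.const_mul (invphi F m : ℝ)
  · refine Eventually.of_forall fun i m => ?_
    rw [Real.norm_of_nonneg (ff_nn i m)]
    exact ff_bound i m

theorem aa_inv (l : ℕ) : (1 - xr F ^ (l + 1)) * aa F l = 1 := by
  have := xr_pow_le (F := F) l
  rw [aa, mul_inv_cancel₀]
  linarith

theorem ff_rec (i : ℕ) : ff F i = aa F i * ff F (i + 1) := by
  have h : ff F i = ff F (i + 1) + xr F ^ (i + 1) * ff F i := by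
    have e1 := (summable_ff (F := F) i).tsum_eq_zero_add
    have e2 := (summable_ff (F := F) (i + 1)).tsum_eq_zero_add
    have s1 := (summable_nat_add_iff 1).2 (summable_ff (F := F) (i + 1))
    have s2 := (summable_ff (F := F) i).mul_left (xr F ^ (i + 1))
    change ff F i = _ at e1
    change ff F (i + 1) = _ at e2
    rw [e1, e2]
    conv_rhs => rw [← e1, ff, ← tsum_mul_left, add_assoc, ← s1.tsum_add s2]
    refine congrArg₂ (· + ·) ?_ ?_
    · rw [pow_zero, pow_zero]
    · refine tsum_congr fun m => ?_
      have e3 : (invphi F (m + 1) : ℝ) = invphi F m * aa F m := by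
        rw [invphi_eq, invphi_eq, Finset.prod_range_succ]
      have e4 := aa_inv (F := F) m
      have e5 : (invphi F m : ℝ) = (1 - xr F ^ (m + 1)) * invphi F (m + 1) := by
        rw [e3]; linear_combination - (invphi F m : ℝ) * e4
      rw [e5, ← pow_mul, ← pow_mul, ← pow_mul]
      ring
  have h2 := aa_inv (F := F) i
  linear_combination aa F i * h - ff F i * h2

theorem ff_prod (i N : ℕ) : ff F i = (∏ l ∈ Finset.range N, aa F (i + l)) * ff F (i + N) := by
  induction N with
  | zero => simp
  | succ N ih => rw [ih, ff_rec (i + N), Finset.prod_range_succ]; ring_nf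

theorem summable_la_add (i : ℕ) : Summable (fun l => la F (i + l)) := by
  simp_rw [add_comm i]
  exact (summable_nat_add_iff i).2 summable_la

theorem ff_exp (i : ℕ) : ff F i = Real.exp (∑' l, la F (i + l)) := by
  have h1 : Tendsto (fun N => (∏ l ∈ Finset.range N, aa F (i + l)) * ff F (i + N)) atTop
      (nhds (Real.exp (∑' l, la F (i + l)) * 1)) := by
    refine Tendsto.mul ?_ ?_
    · simp_rw [prod_aa]
      exact (Real.continuous_exp.tendsto _).comp (summable_la_add i).hasSum.tendsto_sum_nat
    · simp_rw [add_comm i]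
      exact tendsto_ff.comp (tendsto_add_atTop_nat i)
  rw [mul_one] at h1
  refine tendsto_nhds_unique ?_ h1
  refine tendsto_const_nhds.congr fun N => ff_prod i N

noncomputable def TL (F : Type) [Field F] [Fintype F] : ℝ := ∑' l : ℕ, ((l : ℝ) + 1) * la F l

theorem TL_nonneg : 0 ≤ TL F := tsum_nonneg fun l => mul_nonneg (by positivity) (la_nonneg l)

theorem tendsto_gsum : Tendsto (fun K => ∑ t ∈ Finset.range K, ∑' l, la F (t + l)) atTop
    (nhds (TL F)) := by
  have h1 := tsum_anti (fun p : ℕ × ℕ => ENNReal.ofReal (la F (p.1 + p.2)))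
  have h2 : ∀ n, ∑ p ∈ Finset.HasAntidiagonal.antidiagonal n, ENNReal.ofReal (la F (p.1 + p.2)) =
      ENNReal.ofReal (((n : ℝ) + 1) * la F n) := by
    intro n
    rw [Finset.sum_congr rfl (g := fun _ => ENNReal.ofReal (la F n))]
    · rw [Finset.sum_const, Finset.Nat.card_antidiagonal, ENNReal.ofReal_mul (by positivity),
        nsmul_eq_mul]
      congr 1
      rw [← Nat.cast_succ, ENNReal.ofReal_natCast]
    · intro p hp
      rw [Finset.HasAntidiagonal.mem_antidiagonal.1 hp]
  simp_rw [h2] at h1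
  rw [← ENNReal.ofReal_tsum_of_nonneg (fun l => mul_nonneg (by positivity) (la_nonneg l))
    summable_nla] at h1
  have h3 : ∀ t, ∑' l, ENNReal.ofReal (la F (t + l)) = ENNReal.ofReal (∑' l, la F (t + l)) :=
    fun t => (ENNReal.ofReal_tsum_of_nonneg (fun l => la_nonneg _) (summable_la_add t)).symm
  simp_rw [h3] at h1
  have h4 := ENNReal.tendsto_nat_tsum (fun t => ENNReal.ofReal (∑' l, la F (t + l)))
  rw [← h1] at h4
  have h5 := (ENNReal.tendsto_toReal ENNReal.ofReal_ne_top).comp h4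
  change Tendsto _ _ (nhds (ENNReal.ofReal (TL F)).toReal) at h5
  rw [ENNReal.toReal_ofReal TL_nonneg] at h5
  refine h5.congr fun K => ?_
  rw [Function.comp_apply, ← ENNReal.ofReal_sum_of_nonneg, ENNReal.toReal_ofReal]
  · exact Finset.sum_nonneg fun t _ => tsum_nonneg fun l => la_nonneg _
  · exact fun t _ => tsum_nonneg fun l => la_nonneg _

theorem tsum_nu : ∑' n, (nu F n : ℝ≥0∞) * (xx F : ℝ≥0∞) ^ n = ENNReal.ofReal (Real.exp (TL F)) := by
  refine tendsto_nhds_unique (tendsto_nu (F := F)) ?_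
  have h := (ENNReal.continuous_ofReal.tendsto _).comp
    ((Real.continuous_exp.tendsto _).comp (tendsto_gsum (F := F)))
  refine h.congr fun K => ?_
  simp only [Function.comp_apply, Fz_eq, ff_exp]
  rw [← ENNReal.ofReal_prod_of_nonneg (fun t _ => (Real.exp_pos _).le), Real.exp_sum]

theorem hasSum_nu : HasSum (fun n => (nu F n : ℝ) * xr F ^ n) (Real.exp (TL F)) := by
  have h1 := tsum_nu (F := F)
  have h2 : ∀ n, (nu F n : ℝ≥0∞) * (xx F : ℝ≥0∞) ^ n = ((nu F n * xx F ^ n : ℝ≥0) : ℝ≥0∞) := by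
    intro n; push_cast; rfl
  simp_rw [h2] at h1
  have h3 : Summable (fun n => nu F n * xx F ^ n) := by
    rw [← ENNReal.tsum_coe_ne_top_iff_summable, h1]
    exact ENNReal.ofReal_ne_top
  rw [← ENNReal.coe_tsum h3, ENNReal.ofReal, ENNReal.coe_inj] at h1
  have h4 := h3.hasSum
  rw [h1, ← NNReal.hasSum_coe, Real.coe_toNNReal _ (Real.exp_pos _).le] at h4
  convert h4 using 2 with n
  rw [xr]
  push_cast
  rfl

theorem SS_eq : SS F = ENNReal.ofReal (II F) := by
  refine tendsto_nhds_unique (tendsto_SS (F := F)) ?_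
  refine ((ENNReal.continuous_ofReal.tendsto _).comp (tendsto_invphi (F := F))).congr fun K => ?_
  simp only [Function.comp_apply, invphi_eq]
  rw [ENNReal.ofReal_prod_of_nonneg fun t _ => by have := aa_ge (F := F) t; linarith]
  refine Finset.prod_congr rfl fun i _ => ?_
  have := xr_pow_le (F := F) i
  rw [aa, ENNReal.ofReal_inv_of_pos (by linarith), ENNReal.ofReal_sub _ (pow_pos xr_pos _).le,
    ENNReal.ofReal_one, ENNReal.ofReal_pow xr_pos.le, xr, ENNReal.ofReal_coe_nnreal]

theorem tendsto_cc_real : Tendsto (fun n => (cc F n : ℝ) * xr F ^ n) atTop (nhds (II F)) := by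
  have h := tendsto_cc (F := F)
  rw [SS_eq] at h
  have h5 := (ENNReal.tendsto_toReal ENNReal.ofReal_ne_top).comp h
  rw [ENNReal.toReal_ofReal (show 0 ≤ II F from (Real.exp_pos _).le)] at h5
  refine h5.congr fun n => ?_
  simp [xr]

theorem tendsto_conv {u v : ℕ → ℝ} {U V : ℝ} (hu0 : ∀ n, 0 ≤ u n) (hu : HasSum u U)
    (hv : Tendsto v atTop (nhds V)) :
    Tendsto (fun n => ∑ p ∈ Finset.HasAntidiagonal.antidiagonal n, u p.1 * v p.2) atTop
      (nhds (U * V)) := by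
  obtain ⟨C, hC⟩ := hv.norm.bddAbove_range
  have hC' : ∀ n, |v n| ≤ C := fun n => hC ⟨n, rfl⟩
  rw [← hu.tsum_eq, ← tsum_mul_right]
  have key : Tendsto (fun n => ∑' k, if k ≤ n then u k * v (n - k) else 0) atTop
      (nhds (∑' k, u k * V)) := by
    refine tendsto_tsum_of_dominated_convergence (bound := fun k => u k * C)
      (hu.summable.mul_right C) ?_ ?_
    · intro k
      have h1 : Tendsto (fun n => u k * v (n - k)) atTop (nhds (u k * V)) :=
        (hv.comp (tendsto_sub_atTop_nat k)).const_mul _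
      refine h1.congr' ?_
      filter_upwards [eventually_ge_atTop k] with n hn
      rw [if_pos hn]
    · refine Eventually.of_forall fun n k => ?_
      have hC0 : 0 ≤ C := (abs_nonneg _).trans (hC' 0)
      split_ifs
      · rw [norm_mul, Real.norm_of_nonneg (hu0 k)]
        exact mul_le_mul_of_nonneg_left (hC' _) (hu0 k)
      · rw [norm_zero]; exact mul_nonneg (hu0 k) hC0
  refine key.congr fun n => ?_
  rw [Finset.Nat.sum_antidiagonal_eq_sum_range_succ (fun a b => u a * v b),
    tsum_eq_sum (s := Finset.range (n + 1))]
  · refine Finset.sum_congr rfl fun k hk => ?_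
    rw [if_pos (Nat.lt_succ_iff.1 (Finset.mem_range.1 hk))]
  · intro k hk
    rw [if_neg]
    intro h
    exact hk (Finset.mem_range.2 (Nat.lt_succ_iff.2 h))

end FF

namespace FF
set_option linter.unusedSectionVars false
set_option linter.unusedVariables false
open scoped ENNReal NNReal
open Filter
variable {F : Type} [Field F] [Fintype F]

theorem commPairs_eq (n : ℕ) : commPairs F n = Nat.card (AllP F n) := by
  let e : Matrix (Fin n) (Fin n) F ≃ₐ[F] Module.End F (Fin n → F) := Matrix.toLinAlgEquiv'
  refine Nat.card_congr ((e.toEquiv.prodCongr e.toEquiv).subtypeEquiv fun P => ?_)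
  show _ ↔ e P.1 * e P.2 = e P.2 * e P.1
  rw [← map_mul, ← map_mul, e.injective.eq_iff]

theorem ratio_eq (n : ℕ) : (commPairs F n : ℝ) / (Fintype.card F : ℝ) ^ (n ^ 2 + n) =
    (∑ p ∈ Finset.HasAntidiagonal.antidiagonal n,
      ((nu F p.1 : ℝ) * xr F ^ p.1) * ((cc F p.2 : ℝ) * xr F ^ p.2)) / (invphi F n : ℝ) := by
  have h1 := congrArg (fun z : ℝ≥0 => (z : ℝ)) (allP_eq (F := F) n)
  rw [← commPairs_eq] at h1
  push_cast at h1
  have h2 : ∑ p ∈ Finset.HasAntidiagonal.antidiagonal n,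
      ((nu F p.1 : ℝ) * xr F ^ p.1) * ((cc F p.2 : ℝ) * xr F ^ p.2) =
      ((commPairs F n : ℝ) / gl F n) * xr F ^ n := by
    rw [h1, Finset.sum_mul]
    refine Finset.sum_congr rfl fun p hp => ?_
    have hg : (gl F p.2 : ℝ) ≠ 0 := by exact_mod_cast (gl_pos (F := F) p.2).ne'
    rw [invPairs_eq, ← Finset.HasAntidiagonal.mem_antidiagonal.1 hp, pow_add, Nat.cast_mul,
      mul_div_cancel_right₀ _ hg, cc]
    ring
  have h0 : (invphi F n : ℝ) = (Fintype.card F : ℝ) ^ (n * n) / (gl F n : ℝ) := by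
    rw [invphi]; push_cast; rfl
  have hg : (gl F n : ℝ) ≠ 0 := by exact_mod_cast (gl_pos (F := F) n).ne'
  have hq : (Fintype.card F : ℝ) ≠ 0 := by exact_mod_cast Fintype.card_ne_zero
  rw [h2, h0, xr_eq, inv_pow, pow_add, sq]
  field_simp

theorem main_tendsto : Tendsto
    (fun n : ℕ => (commPairs F n : ℝ) / (Fintype.card F : ℝ) ^ (n ^ 2 + n)) atTop
    (nhds (Real.exp (TL F))) := by
  simp_rw [ratio_eq]
  have hI : II F ≠ 0 := (Real.exp_pos _).ne'
  have h := (tendsto_conv (fun n => mul_nonneg (NNReal.coe_nonneg (nu F n))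
    (pow_pos (xr_pos (F := F)) n).le) hasSum_nu (tendsto_cc_real (F := F))).div (tendsto_invphi (F := F)) hI
  rwa [mul_div_cancel_right₀ _ hI] at h

end FF

theorem feit_fine_asymptotics
    (q : ℕ) (hq : ∃ p m : ℕ, p.Prime ∧ 0 < m ∧ q = p ^ m)
    (F : Type) [Field F] [Fintype F] (hF : Fintype.card F = q) :
    Multipliable (fun j : ℕ => ((1 - (q : ℝ) ^ (-(j : ℤ) - 1))⁻¹) ^ (j + 1)) ∧
    Filter.Tendsto
      (fun n : ℕ => (commPairs F n : ℝ) / (q : ℝ) ^ (n ^ 2 + n))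
      Filter.atTop
      (nhds (∏' j : ℕ, ((1 - (q : ℝ) ^ (-(j : ℤ) - 1))⁻¹) ^ (j + 1))) := by
  have hfun : (fun j : ℕ => ((1 - (q : ℝ) ^ (-(j : ℤ) - 1))⁻¹) ^ (j + 1)) =
      fun j : ℕ => FF.aa F j ^ (j + 1) := by
    funext j
    rw [FF.aa, FF.xr_eq, hF]
    have : (q : ℝ) ^ (-(j : ℤ) - 1) = ((q : ℝ)⁻¹) ^ (j + 1) := by
      rw [inv_pow, ← zpow_natCast, ← zpow_neg]
      congr 1
      push_cast
      ring
    rw [this]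
  have hpos : ∀ j : ℕ, 0 < FF.aa F j ^ (j + 1) := fun j =>
    pow_pos (by have := FF.aa_ge (F := F) j; linarith) _
  have hlog : (fun j : ℕ => Real.log (FF.aa F j ^ (j + 1))) =
      fun j : ℕ => ((j : ℝ) + 1) * FF.la F j := by
    funext j
    rw [Real.log_pow, FF.la]
    push_cast
    rfl
  have hsum : Summable (fun j : ℕ => Real.log (FF.aa F j ^ (j + 1))) := by
    rw [hlog]; exact FF.summable_nla
  rw [hfun]
  refine ⟨Real.multipliable_of_summable_log hpos hsum, ?_⟩
  rw [← Real.rexp_tsum_eq_tprod hpos hsum, hlog, ← hF]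
  exact FF.main_tendsto
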